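/- arXiv:math/0308263 — 3 statements merged into one kernel-verified Lean document; each statement's English description precedes it below -/
import Mathlib

section
/- For all integers s ≥ 0 and k ≥ 0, the R/I-module Tor_k^R(R/I, I^s) is free. -/
open CategoryTheory

noncomputable section

/-- The functor `Tor_k^R(R/I, -)` on `R`-modules. -/
def TorF (R : Type) [CommRing R] (I : Ideal R) (k : ℕ) :
    ModuleCat R ⥤ ModuleCat R :=
  (Tor (ModuleCat R) k).obj (ModuleCat.of R (R ⧸ I))

end

/-- A complex of modules with an augmentation to the ring. -/
structure ResC (R : Type) [CommRing R] where
  X : ℕ → ModuleCat.{0} R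
  d : ∀ k, X (k+1) →ₗ[R] X k
  ε : X 0 →ₗ[R] R

/-- The complex is a free resolution of the ideal `A`, minimal with respect to `J`. -/
structure ResC.Good {R : Type} [CommRing R] (P : ResC R) (J A : Ideal R) : Prop where
  free : ∀ k, Module.Free R (P.X k)
  rng : ∀ a, a ∈ A ↔ ∃ y, P.ε y = a
  ε_d : ∀ y, P.ε (P.d 0 y) = 0
  d_d : ∀ k y, P.d k (P.d (k+1) y) = 0
  ex0 : ∀ y, P.ε y = 0 → ∃ z, P.d 0 z = y
  ex : ∀ k y, P.d k y = 0 → ∃ z, P.d (k+1) z = y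
  min : ∀ k y, P.d k y ∈ (J • ⊤ : Submodule R (P.X k))

/-- Chain maps over the identity of the ring. -/
structure ResM {R : Type} [CommRing R] (P Q : ResC R) where
  f : ∀ k, P.X k →ₗ[R] Q.X k
  comm : ∀ k y, f k (P.d k y) = Q.d k (f (k+1) y)
  ε_comm : ∀ y, Q.ε (f 0 y) = P.ε y

/-- Composition. -/
def ResM.comp {R : Type} [CommRing R] {P Q S : ResC R} (g : ResM Q S) (f : ResM P Q) : ResM P S where
  f k := g.f k ∘ₗ f.f k
  comm k y := by simp [f.comm, g.comm]
  ε_comm y := by simp [f.ε_comm, g.ε_comm]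

lemma map_min {R : Type} [CommRing R] {J I : Ideal R} (h : J ≤ I) {M N : Type}
    [AddCommGroup M] [AddCommGroup N] [Module R M] [Module R N] (f : M →ₗ[R] N) {y : M}
    (hy : y ∈ (J • ⊤ : Submodule R M)) : f y ∈ (I • ⊤ : Submodule R N) := by
  have : f y ∈ (J • ⊤ : Submodule R M).map f := ⟨y, hy, rfl⟩
  rw [Submodule.map_smul''] at this
  exact Submodule.smul_mono h le_top this

/-- The underlying modules of the cone. -/
def coneX {R : Type} [CommRing R] (P Q : ResC R) : ℕ → ModuleCat.{0} R
  | 0 => ModuleCat.of R (P.X 0 × Q.X 0)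
  | k+1 => ModuleCat.of R (P.X k × (P.X (k+1) × Q.X (k+1)))

/-- The inclusion of the second factor. -/
def coneInr {R : Type} [CommRing R] (P Q : ResC R) : ∀ k, (P.X k × Q.X k) →ₗ[R] coneX P Q k
  | 0 => LinearMap.id
  | k+1 => LinearMap.inr R (P.X k) (P.X (k+1) × Q.X (k+1))

/-- The component `(x, -g)`. -/
def coneF {R : Type} [CommRing R] (x : R) {P Q : ResC R} (g : ResM P Q) (k : ℕ) :
    P.X k →ₗ[R] (P.X k × Q.X k) :=
  LinearMap.prod (x • LinearMap.id) (-(g.f k))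

/-- differential of the cone -/
def coneD {R : Type} [CommRing R] (x : R) {P Q : ResC R} (g : ResM P Q) :
    ∀ k, coneX P Q (k+1) →ₗ[R] coneX P Q k
  | 0 => LinearMap.coprod (coneF x g 0) (LinearMap.prodMap (P.d 0) (Q.d 0))
  | k+1 => LinearMap.prod (-(P.d k ∘ₗ LinearMap.fst R (P.X (k+1)) (P.X (k+2) × Q.X (k+2))))
      (LinearMap.coprod (coneF x g (k+1)) (LinearMap.prodMap (P.d (k+1)) (Q.d (k+1))))

/-- The cone. -/
def cone {R : Type} [CommRing R] (x : R) {P Q : ResC R} (g : ResM P Q) : ResC R where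
  X := coneX P Q
  d := coneD x g
  ε := LinearMap.coprod P.ε (x • Q.ε)

/-- Inclusion of `P` in the cone. -/
def coneI {R : Type} [CommRing R] (x : R) {P Q : ResC R} (g : ResM P Q) : ResM P (cone x g) where
  f k := coneInr P Q k ∘ₗ LinearMap.inl R _ _
  comm k y := by
    cases k with
    | zero =>
      change ((P.d 0 y, 0) : P.X 0 × Q.X 0) =
        ((x • (0 : P.X 0) + P.d 0 y, -(g.f 0 (0 : P.X 0)) + Q.d 0 0) : P.X 0 × Q.X 0)
      simp
    | succ k =>
      change ((0, P.d (k+1) y, 0) : P.X k × P.X (k+1) × Q.X (k+1)) =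
        ((-(P.d k 0), x • (0 : P.X (k+1)) + P.d (k+1) y, -(g.f (k+1) (0 : P.X (k+1))) +
          Q.d (k+1) 0) : P.X k × P.X (k+1) × Q.X (k+1))
      simp
  ε_comm y := by
    change P.ε y + x * Q.ε 0 = P.ε y
    simp

/-- Projection-like maps from the cone to `Q`. -/
def coneP {R : Type} [CommRing R] (x : R) {P Q : ResC R} (g : ResM P Q) :
    ∀ k, coneX P Q k →ₗ[R] Q.X k
  | 0 => LinearMap.coprod (g.f 0) (x • LinearMap.id)
  | k+1 => LinearMap.coprod (g.f (k+1)) (x • LinearMap.id) ∘ₗ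
      LinearMap.snd R (P.X k) (P.X (k+1) × Q.X (k+1))

/-- The chain map from the cone to `Q`. -/
def coneφ {R : Type} [CommRing R] (x : R) {P Q : ResC R} (g : ResM P Q) : ResM (cone x g) Q where
  f := coneP x g
  comm k y := by
    cases k with
    | zero =>
      obtain ⟨a, b, c⟩ := y
      change g.f 0 (x • a + P.d 0 b) + x • (-(g.f 0 a) + Q.d 0 c) = Q.d 0 (g.f 1 b + x • c)
      simp [g.comm]
      abel
    | succ k =>
      obtain ⟨a, b, c⟩ := y
      change g.f (k+1) (x • a + P.d (k+1) b) + x • (-(g.f (k+1) a) + Q.d (k+1) c) =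
        Q.d (k+1) (g.f (k+2) b + x • c)
      simp [g.comm]
      abel
  ε_comm y := by
    obtain ⟨a, b⟩ := y
    change Q.ε (g.f 0 a + x • b) = P.ε a + x * Q.ε b
    simp [g.ε_comm]

lemma coneφ_min {R : Type} [CommRing R] {J I : Ideal R} (h : J ≤ I) {x : R} (hx : x ∈ I)
    {P Q : ResC R} (g : ResM P Q) (hg : ∀ k y, g.f k y ∈ (J • ⊤ : Submodule R (Q.X k)))
    (k : ℕ) (y : (cone x g).X k) : (coneφ x g).f k y ∈ (I • ⊤ : Submodule R (Q.X k)) := by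
  have aux : ∀ k (b : P.X k) (c : Q.X k), g.f k b + x • c ∈ (I • ⊤ : Submodule R (Q.X k)) :=
    fun k b c => add_mem (Submodule.smul_mono_left h (hg k b))
      (Submodule.smul_mem_smul hx trivial)
  cases k with
  | zero => 
    obtain ⟨b, c⟩ := y
    exact aux 0 b c
  | succ k =>
    obtain ⟨a, b, c⟩ := y
    exact aux (k+1) b c

lemma cone_good {R : Type} [CommRing R] {J I A B C : Ideal R} (h : J ≤ I) {x : R} (hx : x ∈ I)
    {P Q : ResC R} (hP : P.Good J A) (hQ : Q.Good I B)
    (hC : ∀ c, c ∈ C ↔ ∃ a ∈ A, ∃ b ∈ B, a + x * b = c) (hA : ∀ b, x * b ∈ A → b ∈ A)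
    (g : ResM P Q) (hg : ∀ k y, g.f k y ∈ (I • ⊤ : Submodule R (Q.X k))) :
    (cone x g).Good I C := by
  have hD : ∀ k (a : P.X k) (b : P.X (k+1)) (c : Q.X (k+1)),
      ((x • a + P.d k b, - g.f k a + Q.d k c) : P.X k × Q.X k) ∈
        (I • ⊤ : Submodule R (P.X k × Q.X k)) := by
    intro k a b c
    have h1 : x • a + P.d k b ∈ (I • ⊤ : Submodule R (P.X k)) :=
      add_mem (Submodule.smul_mem_smul hx trivial) (Submodule.smul_mono_left h (hP.min k b))
    have h2 : - g.f k a + Q.d k c ∈ (I • ⊤ : Submodule R (Q.X k)) :=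
      add_mem (neg_mem (hg k a)) (hQ.min k c)
    have := add_mem (map_min le_rfl (LinearMap.inl R (P.X k) (Q.X k)) h1)
      (map_min le_rfl (LinearMap.inr R (P.X k) (Q.X k)) h2)
    simpa using this
  have key : ∀ k (a' : P.X (k+1)) (b : P.X (k+1)) (c : Q.X (k+1)),
      x • P.d k a' = P.d k b → -(g.f k (P.d k a')) = Q.d k c →
      (∀ y, P.d k y = 0 → ∃ z, P.d (k+1) z = y) → 
      ∃ u v, x • a' + P.d (k+1) u = b ∧ -(g.f (k+1) a') + Q.d (k+1) v = c := by
    intro k a' b c h1 h2 _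
    obtain ⟨u, hu⟩ := hP.ex k (b - x • a') (by simp [h1])
    obtain ⟨v, hv⟩ := hQ.ex k (c + g.f (k+1) a') (by simp [← h2, g.comm])
    exact ⟨u, v, by simp [hu], by simp [hv]⟩
  refine ⟨?_, ?_, ?_, ?_, ?_, ?_, ?_⟩
  · intro k
    have := hP.free
    have := hQ.free
    cases k with
    | zero => exact inferInstanceAs (Module.Free R (P.X 0 × Q.X 0))
    | succ k => exact inferInstanceAs (Module.Free R (P.X k × (P.X (k+1) × Q.X (k+1))))
  · intro c
    rw [hC]
    constructor
    · rintro ⟨a, ha, b, hb, rfl⟩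
      obtain ⟨p, rfl⟩ := (hP.rng a).1 ha
      obtain ⟨q, rfl⟩ := (hQ.rng b).1 hb
      exact ⟨(p, q), rfl⟩
    · rintro ⟨⟨p, q⟩, rfl⟩
      exact ⟨P.ε p, (hP.rng _).2 ⟨p, rfl⟩, Q.ε q, (hQ.rng _).2 ⟨q, rfl⟩, rfl⟩
  · rintro ⟨a, b, c⟩
    change P.ε (x • a + P.d 0 b) + x * Q.ε (-(g.f 0 a) + Q.d 0 c) = 0
    simp [hP.ε_d, hQ.ε_d, g.ε_comm]
  · intro k y
    cases k with
    | zero =>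
      obtain ⟨a, b, c⟩ := y
      change ((x • (-(P.d 0 a)) + P.d 0 (x • a + P.d 1 b),
        -(g.f 0 (-(P.d 0 a))) + Q.d 0 (-(g.f 1 a) + Q.d 1 c)) : P.X 0 × Q.X 0) = (0, 0)
      simp [hP.d_d, hQ.d_d, g.comm]
    | succ k =>
      obtain ⟨a, b, c⟩ := y
      change ((-(P.d k (-(P.d (k+1) a))), x • (-(P.d (k+1) a)) + P.d (k+1) (x • a + P.d (k+2) b),
        -(g.f (k+1) (-(P.d (k+1) a))) + Q.d (k+1) (-(g.f (k+2) a) + Q.d (k+2) c)) :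
          P.X k × P.X (k+1) × Q.X (k+1)) = (0, 0, 0)
      simp [hP.d_d, hQ.d_d, g.comm]
  · rintro ⟨p, q⟩ hy
    have hy' : P.ε p + x * Q.ε q = 0 := hy
    have h1 : Q.ε q ∈ A := hA _ (by
      rw [← neg_eq_of_add_eq_zero_right hy']
      exact neg_mem ((hP.rng _).2 ⟨p, rfl⟩))
    obtain ⟨a, ha⟩ := (hP.rng _).1 h1
    obtain ⟨u, hu⟩ := hP.ex0 (p + x • a) (by simp [ha, hy'])
    obtain ⟨v, hv⟩ := hQ.ex0 (q - g.f 0 a) (by simp [ha, g.ε_comm])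
    refine ⟨((-a, u, v) : P.X 0 × (P.X 1 × Q.X 1)), ?_⟩
    change ((x • (-a) + P.d 0 u, -(g.f 0 (-a)) + Q.d 0 v) : P.X 0 × Q.X 0) = (p, q)
    simp [hu, hv]
  · intro k y hy
    cases k with
    | zero =>
      obtain ⟨a, b, c⟩ := y
      have hy' : ((x • a + P.d 0 b, - g.f 0 a + Q.d 0 c) : P.X 0 × Q.X 0) = (0, 0) := hy
      obtain ⟨h1, h2⟩ := Prod.mk.inj hy'
      have h3 : P.ε a = 0 := by
        have := congrArg Q.ε h2
        simpa [g.ε_comm, hQ.ε_d] using this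
      obtain ⟨a', rfl⟩ := hP.ex0 a h3
      obtain ⟨u, v, hu, hv⟩ := key 0 (-a') b c (by
        rw [map_neg, smul_neg]; exact neg_eq_of_add_eq_zero_right h1) (by
        rw [map_neg, map_neg, neg_neg]; rw [neg_add_eq_zero] at h2; exact h2) (hP.ex 0)
      refine ⟨((-a', u, v) : P.X 1 × (P.X 2 × Q.X 2)), ?_⟩
      change ((-(P.d 0 (-a')), x • (-a') + P.d 1 u, -(g.f 1 (-a')) + Q.d 1 v) :
        P.X 0 × (P.X 1 × Q.X 1)) = (P.d 0 a', b, c)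
      refine Prod.ext (by simp) (Prod.ext hu hv)
    | succ k =>
      obtain ⟨a, b, c⟩ := y
      have hy' : ((-(P.d k a), x • a + P.d (k+1) b, - g.f (k+1) a + Q.d (k+1) c) :
        P.X k × (P.X (k+1) × Q.X (k+1))) = (0, 0, 0) := hy
      obtain ⟨h0, h12⟩ := Prod.mk.inj hy'
      obtain ⟨h1, h2⟩ := Prod.mk.inj h12
      obtain ⟨a', rfl⟩ := hP.ex k a (by simpa using h0)
      obtain ⟨u, v, hu, hv⟩ := key (k+1) (-a') b c (by
        rw [map_neg, smul_neg]; exact neg_eq_of_add_eq_zero_right h1) (by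
        rw [map_neg, map_neg, neg_neg]; rw [neg_add_eq_zero] at h2; exact h2) (hP.ex _)
      refine ⟨((-a', u, v) : P.X (k+2) × (P.X (k+3) × Q.X (k+3))), ?_⟩
      change ((-(P.d (k+1) (-a')), x • (-a') + P.d (k+2) u, -(g.f (k+2) (-a')) + Q.d (k+2) v) :
        P.X (k+1) × (P.X (k+2) × Q.X (k+2))) = (P.d (k+1) a', b, c)
      refine Prod.ext (by simp) (Prod.ext hu hv)
  · intro k y
    cases k with
    | zero =>
      obtain ⟨a, b, c⟩ := y
      exact hD 0 a b c
    | succ k =>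
      obtain ⟨a, b, c⟩ := y
      have h1 := map_min h (LinearMap.inl R (P.X k) (P.X (k+1) × Q.X (k+1)))
        (neg_mem (hP.min k a))
      have h2 := map_min le_rfl (LinearMap.inr R (P.X k) (P.X (k+1) × Q.X (k+1)))
        (hD (k+1) a b c)
      have h3 := add_mem h1 h2
      simp only [LinearMap.inl_apply, LinearMap.inr_apply, Prod.mk_add_mk, add_zero, zero_add]
        at h3
      exact h3

/-- Compatible minimal resolutions of all powers of `J`. -/
def HasTower {R : Type} [CommRing R] (J : Ideal R) : Prop :=
  ∃ P : ℕ → ResC R, (∀ s, (P s).Good J (J ^ s)) ∧ ∃ φ : ∀ s, ResM (P (s+1)) (P s),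
    ∀ s k y, (φ s).f k y ∈ (J • ⊤ : Submodule R ((P s).X k))

lemma free_reg {R : Type} [CommRing R] {J : Ideal R} {x : R} (hx : ∀ b, x * b ∈ J → b ∈ J)
    {M : Type} [AddCommGroup M] [Module R M] [Module.Free R M] (p : M)
    (hp : x • p ∈ (J • ⊤ : Submodule R M)) : p ∈ (J • ⊤ : Submodule R M) := by
  let b := Module.Free.chooseBasis R M
  have : ∀ i, b.repr p i ∈ J := by
    intro i
    apply hx
    have := map_min le_rfl (b.coord i) hp
    simpa using this
  rw [← b.linearCombination_repr p, Finsupp.linearCombination_apply]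
  exact Submodule.sum_mem _ fun i _ => Submodule.smul_mem_smul (this i) trivial

lemma reg_pow {R : Type} [CommRing R] {J : Ideal R} {x : R} (hx : ∀ b, x * b ∈ J → b ∈ J)
    {P : ℕ → ResC R} (hP : ∀ s, (P s).Good J (J ^ s)) (s : ℕ) :
    ∀ b, x * b ∈ J ^ s → b ∈ J ^ s := by
  induction s with
  | zero => simp
  | succ s ih =>
    intro b hb
    have h1 : b ∈ J ^ s := ih b (Ideal.pow_le_pow_right (Nat.le_succ s) hb)
    obtain ⟨p, rfl⟩ := ((hP s).rng _).1 h1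
    have hr : (⊤ : Submodule R ((P s).X 0)).map (P s).ε = J ^ s := by
      ext a
      rw [(hP s).rng]
      simp
    have hm : (J • ⊤ : Submodule R ((P s).X 0)).map (P s).ε = J ^ (s+1) := by
      rw [Submodule.map_smul'', hr, pow_succ', smul_eq_mul]
    rw [← hm] at hb ⊢
    obtain ⟨q, hq, hqe⟩ := hb
    obtain ⟨z, hz⟩ := (hP s).ex0 (x • p - q) (by simp [hqe])
    have hxp : x • p ∈ (J • ⊤ : Submodule R ((P s).X 0)) := by
      have := add_mem ((hP s).min 0 z) hq
      rwa [hz, sub_add_cancel] at this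
    have := (hP s).free 0
    exact ⟨p, free_reg hx p hxp, rfl⟩

lemma pow_sup {R : Type} [CommRing R] (J : Ideal R) (x : R) (s : ℕ) :
    (J ⊔ Ideal.span {x}) ^ (s+1) = J ^ (s+1) ⊔ Ideal.span {x} * (J ⊔ Ideal.span {x}) ^ s := by
  apply le_antisymm
  · induction s with
    | zero => simp
    | succ s ih =>
      conv_lhs => rw [pow_succ', Ideal.sup_mul]
      refine sup_le ?_ le_sup_right
      refine (Ideal.mul_mono_right ih).trans ?_
      rw [Ideal.mul_sup]
      refine sup_le_sup (by rw [← pow_succ']) ?_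
      rw [mul_left_comm]
      refine Ideal.mul_mono_right ?_
      rw [pow_succ']
      exact Ideal.mul_mono_left le_sup_left
  · refine sup_le (Ideal.pow_right_mono le_sup_left _) ?_
    rw [pow_succ']
    exact Ideal.mul_mono_left le_sup_right

/-- Recursive construction of the resolutions for `J ⊔ (x)`. -/
def stepT {R : Type} [CommRing R] (x : R) (P : ℕ → ResC R) (φ : ∀ s, ResM (P (s+1)) (P s)) :
    ∀ s, (Q : ResC R) × ResM (P s) Q
  | 0 => ⟨P 0, ⟨fun _ => LinearMap.id, fun _ _ => rfl, fun _ => rfl⟩⟩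
  | s+1 => ⟨cone x ((stepT x P φ s).2.comp (φ s)), coneI x _⟩

lemma hasTower_step {R : Type} [CommRing R] {J : Ideal R} {x : R}
    (hx : ∀ b, x * b ∈ J → b ∈ J) (h : HasTower J) : HasTower (J ⊔ Ideal.span {x}) := by
  obtain ⟨P, hP, φ, hφ⟩ := h
  have hxI : x ∈ J ⊔ Ideal.span {x} := Ideal.mem_sup_right (Ideal.mem_span_singleton_self x)
  have hg : ∀ s k y, ((stepT x P φ s).2.comp (φ s)).f k y ∈
      (J • ⊤ : Submodule R ((stepT x P φ s).1.X k)) := 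
    fun s k y => map_min le_rfl ((stepT x P φ s).2.f k) (hφ s k y)
  refine ⟨fun s => (stepT x P φ s).1, ?_, fun s => coneφ x _, ?_⟩
  · intro s
    induction s with
    | zero => 
      have h0 := hP 0
      refine ⟨h0.free, ?_, h0.ε_d, h0.d_d, h0.ex0, h0.ex, fun k y => 
        Submodule.smul_mono_left le_sup_left (h0.min k y)⟩
      have := h0.rng
      rw [pow_zero] at this ⊢
      exact this
    | succ s ih =>
      refine cone_good le_sup_left hxI (hP (s+1)) ih ?_ (reg_pow hx hP (s+1)) _ 
        (fun k y => Submodule.smul_mono_left le_sup_left (hg s k y))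
      intro c
      rw [pow_sup, Submodule.mem_sup]
      simp only [Ideal.mem_span_singleton_mul]
      constructor
      · rintro ⟨a, ha, _, ⟨b, hb, rfl⟩, rfl⟩
        exact ⟨a, ha, b, hb, rfl⟩
      · rintro ⟨a, ha, b, hb, rfl⟩
        exact ⟨a, ha, _, ⟨b, hb, rfl⟩, rfl⟩
  · intro s k y
    exact coneφ_min le_sup_left hxI _ (hg s) k y

/-- The trivial complex. -/
def zeroC (R : Type) [CommRing R] : ResC R := ⟨fun _ => ModuleCat.of R PUnit, fun _ => 0, 0⟩

/-- The ring in degree zero. -/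
def oneC (R : Type) [CommRing R] : ResC R where
  X := fun | 0 => ModuleCat.of R R | _+1 => ModuleCat.of R PUnit
  d := fun _ => 0
  ε := LinearMap.id

lemma hasTower_bot (R : Type) [CommRing R] : HasTower (⊥ : Ideal R) := by
  refine ⟨fun | 0 => oneC R | _+1 => zeroC R, ?_, 
    fun | 0 => ⟨fun _ => 0, fun _ _ => rfl, fun _ => rfl⟩ 
        | _+1 => ⟨fun _ => 0, fun _ _ => rfl, fun _ => rfl⟩, ?_⟩
  · intro s
    cases s with
    | zero =>
      refine ⟨?_, ?_, ?_, ?_, ?_, ?_, ?_⟩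
      · intro k
        cases k with
        | zero => exact inferInstanceAs (Module.Free R R)
        | succ k => exact inferInstanceAs (Module.Free R PUnit)
      · intro a
        simp only [pow_zero, Ideal.one_eq_top, Submodule.mem_top, true_iff]
        exact ⟨a, rfl⟩
      · intro y; rfl
      · intro k y; rfl
      · intro y hy
        exact ⟨0, by rw [map_zero]; exact hy.symm⟩
      · intro k y _
        exact ⟨0, Subsingleton.elim (α := PUnit) _ _⟩
      · intro k y; exact zero_mem _
    | succ s =>
      refine ⟨?_, ?_, ?_, ?_, ?_, ?_, ?_⟩
      · intro k
        exact inferInstanceAs (Module.Free R PUnit)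
      · intro a
        rw [← Ideal.zero_eq_bot, zero_pow (Nat.succ_ne_zero s), Ideal.zero_eq_bot, Ideal.mem_bot]
        exact ⟨fun h => ⟨0, h.symm⟩, fun ⟨_, h⟩ => h.symm⟩
      · intro y; rfl
      · intro k y; rfl
      · intro y hy
        exact ⟨0, Subsingleton.elim (α := PUnit) _ _⟩
      · intro k y _
        exact ⟨0, Subsingleton.elim (α := PUnit) _ _⟩
      · intro k y; exact zero_mem _
  · intro s k y
    cases s <;> exact zero_mem _

lemma hasTower_list {R : Type} [CommRing R] (rs : List R)
    (h : RingTheory.Sequence.IsWeaklyRegular R rs) : HasTower (Ideal.ofList rs) := by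
  induction rs using List.reverseRecOn with
  | nil => rw [Ideal.ofList_nil]; exact hasTower_bot R
  | append_singleton rs x ih =>
    rw [RingTheory.Sequence.isWeaklyRegular_append_iff,
      RingTheory.Sequence.isWeaklyRegular_singleton_iff] at h
    rw [Ideal.ofList_append, Ideal.ofList_singleton]
    refine hasTower_step ?_ (ih h.1)
    intro b hb
    have hmem : ∀ c : R, c ∈ (Ideal.ofList rs • ⊤ : Submodule R R) ↔ c ∈ Ideal.ofList rs := by
      intro c; simp
    have h2 := h.2.right_eq_zero_of_smul
      (x := (Submodule.Quotient.mk b : R ⧸ (Ideal.ofList rs • ⊤ : Submodule R R))) (by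
      rw [← Submodule.Quotient.mk_smul, Submodule.Quotient.mk_eq_zero, hmem]
      exact hb)
    rwa [Submodule.Quotient.mk_eq_zero, hmem] at h2

open CategoryTheory in
/-- The associated chain complex. -/
noncomputable def ResC.cx {R : Type} [CommRing R] (P : ResC R)
    (h : ∀ k y, P.d k (P.d (k+1) y) = 0) : ChainComplex (ModuleCat.{0} R) ℕ :=
  ChainComplex.of P.X (fun k => ModuleCat.ofHom (P.d k)) (fun k => by
    ext y; exact h k y)

open CategoryTheory in
lemma ResC.cx_d {R : Type} [CommRing R] (P : ResC R)
    (h : ∀ k y, P.d k (P.d (k+1) y) = 0) (k : ℕ) :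
    (P.cx h).d (k+1) k = ModuleCat.ofHom (P.d k) := by
  simp [ResC.cx, ChainComplex.of_d]

/-- The augmentation, with values in the ideal. -/
def ResC.aug {R : Type} [CommRing R] (P : ResC R) {J A : Ideal R} (hP : P.Good J A) :
    P.X 0 →ₗ[R] A := P.ε.codRestrict A fun y => (hP.rng _).2 ⟨y, rfl⟩

open CategoryTheory in
/-- The projective resolution. -/
noncomputable def ResC.res {R : Type} [CommRing R] (P : ResC R) {J A : Ideal R}
    (hP : P.Good J A) : ProjectiveResolution (ModuleCat.of R A) where
  complex := P.cx hP.d_d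
  projective n := by
    have := hP.free n
    exact inferInstanceAs (Projective (P.X n))
  π := (ChainComplex.toSingle₀Equiv _ _).symm ⟨ModuleCat.ofHom (P.aug hP), by
    rw [P.cx_d]
    ext y
    exact hP.ε_d y⟩
  quasiIso := ⟨fun n => by
    cases n with
    | zero =>
      rw [ChainComplex.quasiIsoAt₀_iff, ShortComplex.quasiIso_iff_of_zeros']
      · let S : ShortComplex (ModuleCat.{0} R) :=
          ShortComplex.mk (ModuleCat.ofHom (P.d 0)) (ModuleCat.ofHom (P.aug hP)) (by
            ext y
            exact hP.ε_d y)
        have hS : S.Exact ∧ Epi S.g := by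
          constructor
          · rw [ShortComplex.moduleCat_exact_iff]
            intro y hy
            exact hP.ex0 y (congrArg Subtype.val hy)
          · rw [ModuleCat.epi_iff_surjective]
            rintro ⟨a, ha⟩
            obtain ⟨y, hy⟩ := (hP.rng a).1 ha
            exact ⟨y, Subtype.ext hy⟩
        refine (ShortComplex.exact_and_epi_g_iff_of_iso ?_).2 hS
        refine ShortComplex.isoMk (Iso.refl _) (Iso.refl _) (Iso.refl _) ?_ ?_
        · simp [S]
          exact (P.cx_d hP.d_d 0).symm
        · simp [S]
          rfl
      all_goals rfl
    | succ n =>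
      rw [quasiIsoAt_iff_exactAt']
      · rw [HomologicalComplex.exactAt_iff' _ (n + 1 + 1) (n + 1) n (by simp) (by simp)]
        rw [ShortComplex.moduleCat_exact_iff]
        intro y hy
        obtain ⟨z, hz⟩ := hP.ex n y (by
          have h2 : (P.cx hP.d_d).d (n+1) n y = 0 := hy
          rw [P.cx_d] at h2
          exact h2)
        refine ⟨z, ?_⟩
        change (P.cx hP.d_d).d (n+1+1) (n+1) z = y
        rw [P.cx_d]
        exact hz
      · apply ChainComplex.exactAt_succ_single_obj⟩

open TensorProduct in
lemma lTensor_zero_of_min {R : Type} [CommRing R] (I : Ideal R) {M N : Type}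
    [AddCommGroup M] [Module R M] [AddCommGroup N] [Module R N] (f : M →ₗ[R] N)
    (h : ∀ y, f y ∈ (I • ⊤ : Submodule R N)) : f.lTensor (R ⧸ I) = 0 := by
  have key : ∀ (b : R ⧸ I) (m : N), m ∈ (I • ⊤ : Submodule R N) → b ⊗ₜ[R] m = 0 := by
    intro b m hm
    induction hm using Submodule.smul_induction_on' with
    | smul c hc m hm =>
      rw [TensorProduct.tmul_smul, TensorProduct.smul_tmul']
      have : c • b = 0 := by
        rw [Algebra.smul_def, Ideal.Quotient.algebraMap_eq, Ideal.Quotient.eq_zero_iff_mem.2 hc,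
          zero_mul]
      rw [this, TensorProduct.zero_tmul]
    | add x hx y hy h1 h2 => rw [TensorProduct.tmul_add, h1, h2, add_zero]
  refine TensorProduct.ext' fun a y => ?_
  rw [LinearMap.lTensor_tmul, key a _ (h y), LinearMap.zero_apply]

open CategoryTheory MonoidalCategory in
lemma tor_equiv {R : Type} [CommRing R] (P : ResC R) {I A : Ideal R}
    (hP : P.Good I A) (k : ℕ) :
    Nonempty ((TorF R I k).obj (ModuleCat.of R A) ≃ₗ[R] TensorProduct R (R ⧸ I) (P.X k)) := by
  let F := (tensoringLeft (ModuleCat.{0} R)).obj (ModuleCat.of R (R ⧸ I))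
  let K := (F.mapHomologicalComplex (ComplexShape.down ℕ)).obj (P.res hP).complex
  have hz : ∀ i j, K.d i j = 0 := by
    intro i j
    by_cases hij : j + 1 = i
    · subst hij
      change F.map ((P.cx hP.d_d).d (j+1) j) = 0
      rw [P.cx_d]
      ext1
      exact lTensor_zero_of_min I (P.d j) (hP.min j)
    · exact K.shape _ _ hij
  let e1 : (TorF R I k).obj (ModuleCat.of R A) ≅ K.homology k := (P.res hP).isoLeftDerivedObj F k
  let e2 : K.homology k ≅ K.X k :=
    (ShortComplex.HomologyData.ofZeros (K.sc k) (hz _ _) (hz _ _)).left.homologyIso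
  exact ⟨(e1 ≪≫ e2).toLinearEquiv⟩

/-- Let `r : Fin n → R` be a regular sequence generating the ideal `I`.
For all `s ≥ 0` and `k ≥ 0`, the `R/I`-module `Tor_k^R(R/I, I^s)` is free
(for any `R/I`-module structure compatible with the `R`-module structure). -/
theorem stmt_7 (R : Type) [CommRing R] {n : ℕ} (r : Fin n → R)
    (hreg : RingTheory.Sequence.IsRegular R (List.ofFn r))
    (I : Ideal R) (hI : I = Ideal.span (Set.range r)) (s k : ℕ)
    [Module (R ⧸ I) ((TorF R I k).obj (ModuleCat.of R ↥(I ^ s)))]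
    [IsScalarTower R (R ⧸ I) ((TorF R I k).obj (ModuleCat.of R ↥(I ^ s)))] :
    Module.Free (R ⧸ I) ((TorF R I k).obj (ModuleCat.of R ↥(I ^ s))) := by
  have hI' : Ideal.ofList (List.ofFn r) = I := by
    rw [hI, Ideal.ofList]
    congr 1
    ext a
    simp
  have hT := hasTower_list _ hreg.toIsWeaklyRegular
  rw [hI'] at hT
  obtain ⟨P, hP, -⟩ := hT
  obtain ⟨e⟩ := tor_equiv (P s) (hP s) k
  have := (hP s).free k
  exact Module.Free.of_equiv
    (LinearEquiv.extendScalarsOfSurjective (R := R) (S := R ⧸ I) Ideal.Quotient.mk_surjective e).symm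
end

section
/- Let A be an R-module such that Tor_k^R(R/I, A) is a free R/I-module for every k ≥ 0. Then for every k ≥ 0 there is an isomorphism of R/I-modules Ext_R^k(A, R/I) ≅ Hom_{R/I}(Tor_k^R(R/I, A), R/I). -/
open CategoryTheory

noncomputable section

/-- The `R`-module `Ext_R^k(M, N)`. -/
def ExtM (R : Type) [CommRing R] (k : ℕ) (M N : Type)
    [AddCommGroup M] [Module R M] [AddCommGroup N] [Module R N] : ModuleCat R :=
  ((Ext R (ModuleCat R) k).obj (Opposite.op (ModuleCat.of R M))).obj (ModuleCat.of R N)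

end

section core
open TensorProduct
variable {R S : Type} [CommRing R] [CommRing S] [Algebra R S]

lemma core1_aux {X1 X2 X3 H : Type} [AddCommGroup X1] [AddCommGroup X2] [AddCommGroup X3]
    [AddCommGroup H] [Module S X1] [Module S X2] [Module S X3] [Module S H]
    [Module.Projective S X2] [Module.Projective S H]
    (f : X1 →ₗ[S] X2) (g : X2 →ₗ[S] X3) (t : X3 →ₗ[S] X2) (ht : ∀ x, g (t (g x)) = g x)
    (hfg : ∀ x, g (f x) = 0)
    (π : LinearMap.ker g →ₗ[S] H) (hπ : Function.Surjective π)
    (hk : ∀ x, π x = 0 ↔ ∃ y, f y = x.1) :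
    ∃ u : X2 →ₗ[S] X1, ∀ x, f (u (f x)) = f x := by
  obtain ⟨σ, hσ⟩ := Module.projective_lifting_property π LinearMap.id hπ
  have hσ' : ∀ x, π (σ x) = x := fun x => LinearMap.congr_fun hσ x
  let e : X2 →ₗ[S] LinearMap.ker g :=
    (LinearMap.id - t ∘ₗ g).codRestrict _ (fun x => by simp [ht])
  have he : ∀ x : LinearMap.ker g, e x.1 = x := by
    intro x; ext; have := x.2; rw [LinearMap.mem_ker] at this; simp [e, this]
  let p : X2 →ₗ[S] LinearMap.range f :=
    ((LinearMap.ker g).subtype ∘ₗ (LinearMap.id - σ ∘ₗ π) ∘ₗ e).codRestrict _ (fun x => by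
      have := (hk (((LinearMap.id : LinearMap.ker g →ₗ[S] LinearMap.ker g) - σ ∘ₗ π) (e x))).1 (by simp [hσ'])
      exact this)
  have hp : ∀ x : LinearMap.range f, p x.1 = x := by
    rintro ⟨_, y, rfl⟩
    ext
    have h1 := he ⟨f y, hfg y⟩
    have h2 := (hk ⟨f y, hfg y⟩).2 ⟨y, rfl⟩
    simp only at h1
    change ((e (f y) - σ (π (e (f y))) : LinearMap.ker g) : X2) = f y
    rw [h1, h2]; simp
  have : Module.Projective S (LinearMap.range f) :=
    Module.Projective.of_split (LinearMap.range f).subtype p (LinearMap.ext hp)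
  obtain ⟨s, hs⟩ := Module.projective_lifting_property f.rangeRestrict LinearMap.id
    f.surjective_rangeRestrict
  refine ⟨s ∘ₗ p, fun x => ?_⟩
  have h1 := LinearMap.congr_fun hs ⟨f x, x, rfl⟩
  have h2 := hp ⟨f x, x, rfl⟩
  simp only at h2
  simpa [h2] using congrArg Subtype.val h1

lemma core1 (hS : Function.Surjective (algebraMap R S))
    {X1 X2 X3 H : Type} [AddCommGroup X1] [AddCommGroup X2] [AddCommGroup X3]
    [AddCommGroup H] [Module S X1] [Module S X2] [Module S X3] [Module S H]
    [Module R X1] [Module R X2] [Module R X3] [Module R H]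
    [IsScalarTower R S X1] [IsScalarTower R S X2] [IsScalarTower R S X3] [IsScalarTower R S H]
    [Module.Projective S X2] [Module.Projective S H]
    (f : X1 →ₗ[R] X2) (g : X2 →ₗ[R] X3) (t : X3 →ₗ[R] X2) (ht : ∀ x, g (t (g x)) = g x)
    (hfg : ∀ x, g (f x) = 0)
    (e : (LinearMap.ker g ⧸ LinearMap.range (f.codRestrict (LinearMap.ker g) hfg)) ≃ₗ[R] H) :
    ∃ u : X2 →ₗ[R] X1, ∀ x, f (u (f x)) = f x := by
  let g' := g.extendScalarsOfSurjective hS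
  let i : LinearMap.ker g' →ₗ[R] LinearMap.ker g :=
    { toFun := fun x => ⟨x.1, x.2⟩, map_add' := fun _ _ => rfl, map_smul' := fun _ _ => rfl }
  let π : LinearMap.ker g' →ₗ[S] H :=
    ((e.toLinearMap ∘ₗ (Submodule.mkQ _)) ∘ₗ i).extendScalarsOfSurjective hS
  obtain ⟨u, hu⟩ := core1_aux (f.extendScalarsOfSurjective hS) g'
    (t.extendScalarsOfSurjective hS) ht hfg π
    (by
      intro y
      obtain ⟨z, rfl⟩ := e.surjective y
      obtain ⟨x, rfl⟩ := Submodule.mkQ_surjective _ z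
      exact ⟨⟨x.1, x.2⟩, rfl⟩)
    (by
      intro x
      have : π x = e (Submodule.mkQ _ (i x)) := rfl
      rw [this, LinearEquiv.map_eq_zero_iff, ← LinearMap.mem_ker, Submodule.ker_mkQ,
        LinearMap.mem_range]
      exact exists_congr fun y => Subtype.ext_iff)
  exact ⟨u.restrictScalars R, hu⟩

/-- extension of scalars of a map to `S` -/
noncomputable def LL (P : Type) [AddCommGroup P] [Module R P] :
    (P →ₗ[R] S) →ₗ[R] (S ⊗[R] P →ₗ[R] S) :=
  (LinearMap.llcomp R (S ⊗[R] P) (S ⊗[R] S) S (LinearMap.mul' R S)) ∘ₗ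
    LinearMap.lTensorHom (R := R) S

@[simp] lemma LL_tmul (P : Type) [AddCommGroup P] [Module R P] (φ : P →ₗ[R] S) (s : S) (p : P) :
    LL P φ (s ⊗ₜ p) = s * φ p := by simp [LL]

lemma LL_surj (hS : Function.Surjective (algebraMap R S)) (P : Type) [AddCommGroup P]
    [Module R P] (ψ : S ⊗[R] P →ₗ[R] S) :
    LL P (ψ ∘ₗ TensorProduct.mk R S P 1) = ψ := by
  ext s p
  obtain ⟨r, rfl⟩ := hS s
  simp only [Algebra.algebraMap_eq_smul_one]
  simp [LL]

lemma LL_inj (P : Type) [AddCommGroup P] [Module R P] (φ φ' : P →ₗ[R] S)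
    (h : LL P φ = LL P φ') : φ = φ' := by
  ext p
  simpa using LinearMap.congr_fun h ((1 : S) ⊗ₜ p)

lemma LL_comp {P Q : Type} [AddCommGroup P] [Module R P] [AddCommGroup Q] [Module R Q]
    (φ : P →ₗ[R] S) (a : Q →ₗ[R] P) : LL Q (φ ∘ₗ a) = LL P φ ∘ₗ a.lTensor S := by
  ext s p
  simp

/-- `LL` as an equivalence -/
noncomputable def LLe (hS : Function.Surjective (algebraMap R S)) (P : Type) [AddCommGroup P]
    [Module R P] : (P →ₗ[R] S) ≃ₗ[R] (S ⊗[R] P →ₗ[R] S) :=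
  LinearEquiv.ofBijective (LL P) ⟨fun _ _ h => LL_inj P _ _ h, fun ψ => ⟨_, LL_surj hS P ψ⟩⟩

lemma LLe_apply (hS : Function.Surjective (algebraMap R S)) (P : Type) [AddCommGroup P]
    [Module R P] (φ : P →ₗ[R] S) : LLe hS P φ = LL P φ := rfl

lemma core2 {T1 T2 T3 U V W : Type} [AddCommGroup T1] [AddCommGroup T2] [AddCommGroup T3]
    [AddCommGroup U] [AddCommGroup V] [AddCommGroup W]
    [Module R T1] [Module R T2] [Module R T3] [Module R U] [Module R V] [Module R W]
    (f : T1 →ₗ[R] T2) (g : T2 →ₗ[R] T3) (t : T3 →ₗ[R] T2) (ht : ∀ x, g (t (g x)) = g x)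
    (hfg : ∀ x, g (f x) = 0)
    (α : U →ₗ[R] V) (β : V →ₗ[R] W) (hαβ : ∀ x, β (α x) = 0)
    (eU : U ≃ₗ[R] (T3 →ₗ[R] S)) (eV : V ≃ₗ[R] (T2 →ₗ[R] S))
    (hα : ∀ u, eV (α u) = eU u ∘ₗ g) (hβ : ∀ v, β v = 0 ↔ eV v ∘ₗ f = 0) :
    Nonempty ((LinearMap.ker β ⧸ LinearMap.range (α.codRestrict (LinearMap.ker β) hαβ)) ≃ₗ[R]
      ((LinearMap.ker g ⧸ LinearMap.range (f.codRestrict (LinearMap.ker g) hfg)) →ₗ[R] S)) := by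
  let N := LinearMap.range (f.codRestrict (LinearMap.ker g) hfg)
  let Φ : LinearMap.ker β →ₗ[R] ((LinearMap.ker g ⧸ N) →ₗ[R] S) :=
    { toFun := fun v => N.liftQ (eV v.1 ∘ₗ (LinearMap.ker g).subtype) (by
        rintro _ ⟨x, rfl⟩
        exact LinearMap.congr_fun ((hβ _).1 v.2) x)
      map_add' := fun v w => by ext x; simp
      map_smul' := fun r v => by ext x; simp }
  have hΦ : ∀ v x, Φ v (Submodule.Quotient.mk x) = eV v.1 x.1 := fun v x => rfl
  have hsurj : Function.Surjective Φ := by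
    intro ψ
    let c : T2 →ₗ[R] LinearMap.ker g :=
      (LinearMap.id - t ∘ₗ g).codRestrict _ (fun x => by simp [ht])
    have hc : ∀ x : LinearMap.ker g, c x.1 = x := by
      intro x; ext; have := x.2; rw [LinearMap.mem_ker] at this; simp [c, this]
    let ψ' : T2 →ₗ[R] S := ψ ∘ₗ N.mkQ ∘ₗ c
    refine ⟨⟨eV.symm ψ', ?_⟩, ?_⟩
    · rw [LinearMap.mem_ker, hβ, LinearEquiv.apply_symm_apply]
      ext x
      have h1 := hc ⟨f x, hfg x⟩
      simp only at h1
      have h2 : N.mkQ ⟨f x, hfg x⟩ = 0 := by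
        rw [Submodule.mkQ_apply, Submodule.Quotient.mk_eq_zero]
        exact ⟨x, rfl⟩
      simp only [ψ', LinearMap.comp_apply, h1, h2, map_zero, LinearMap.zero_apply]
    · refine Submodule.linearMap_qext _ (LinearMap.ext fun x => ?_)
      simp only [LinearMap.comp_apply, Submodule.mkQ_apply, hΦ]
      simp [ψ', hc]
  have hker : LinearMap.ker Φ = LinearMap.range (α.codRestrict (LinearMap.ker β) hαβ) := by
    ext v
    rw [LinearMap.mem_ker, LinearMap.mem_range]
    constructor
    · intro hv
      have hv' : ∀ x : LinearMap.ker g, eV v.1 x.1 = 0 := fun x => by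
        rw [← hΦ, hv]; rfl
      refine ⟨eU.symm (eV v.1 ∘ₗ t), Subtype.ext (eV.injective ?_)⟩
      change eV (α _) = _
      rw [hα, LinearEquiv.apply_symm_apply]
      refine LinearMap.ext fun x => ?_
      have := hv' ⟨x - t (g x), by simp [ht]⟩
      rw [map_sub, sub_eq_zero] at this
      exact this.symm
    · rintro ⟨u, rfl⟩
      refine Submodule.linearMap_qext _ (LinearMap.ext fun x => ?_)
      simp only [LinearMap.comp_apply, Submodule.mkQ_apply, hΦ]
      change eV (α u) x.1 = 0
      rw [hα, LinearMap.comp_apply]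
      have := x.2
      rw [LinearMap.mem_ker] at this
      rw [this]; simp
  exact ⟨(Submodule.quotEquivOfEq _ _ hker.symm).trans (Φ.quotKerEquivOfSurjective hsurj)⟩
end core

section cat
open MonoidalCategory TensorProduct
variable (R : Type) [CommRing R] (I : Ideal R) {X : ModuleCat R}

/-- The tensored complex. -/
noncomputable abbrev TC (P : ProjectiveResolution X) : ChainComplex (ModuleCat R) ℕ :=
  (((tensoringLeft (ModuleCat R)).obj (ModuleCat.of R (R ⧸ I))).mapHomologicalComplex _).obj
    P.complex

noncomputable instance (P : ProjectiveResolution X) (j : ℕ) : Module (R ⧸ I) ((TC R I P).X j) :=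
  inferInstanceAs (Module (R ⧸ I) ((R ⧸ I) ⊗[R] (P.complex.X j)))

instance (P : ProjectiveResolution X) (j : ℕ) : IsScalarTower R (R ⧸ I) ((TC R I P).X j) :=
  inferInstanceAs (IsScalarTower R (R ⧸ I) ((R ⧸ I) ⊗[R] (P.complex.X j)))

instance (P : ProjectiveResolution X) (j : ℕ) : Module.Projective (R ⧸ I) ((TC R I P).X j) := by
  have : Module.Projective R (P.complex.X j) :=
    (IsProjective.iff_projective _).2 (P.projective j)
  exact inferInstanceAs (Module.Projective (R ⧸ I) ((R ⧸ I) ⊗[R] (P.complex.X j)))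

lemma TC_zero (P : ProjectiveResolution X) (i j k : ℕ) (x) :
    ((TC R I P).d j k).hom (((TC R I P).d i j).hom x) = 0 :=
  ((TC R I P).sc' i j k).moduleCat_zero_apply x

/-- Tor as concrete homology -/
noncomputable def torIso (P : ProjectiveResolution X) (i j k : ℕ)
    (hi : (ComplexShape.down ℕ).prev j = i) (hk : (ComplexShape.down ℕ).next j = k) :
    (LinearMap.ker ((TC R I P).d j k).hom ⧸ LinearMap.range
      (((TC R I P).d i j).hom.codRestrict (LinearMap.ker ((TC R I P).d j k).hom)
        (TC_zero R I P i j k))) ≃ₗ[R] ((TorF R I j).obj X) :=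
  (P.isoLeftDerivedObj ((tensoringLeft (ModuleCat R)).obj (ModuleCat.of R (R ⧸ I))) j ≪≫
    ShortComplex.homologyMapIso ((TC R I P).isoSc' i j k hi hk) ≪≫
    ((TC R I P).sc' i j k).moduleCatHomologyIso).symm.toLinearEquiv

lemma YC_zero (P : ProjectiveResolution X) (Y : ModuleCat R) (i j k : ℕ) (x) :
    ((P.complex.linearYonedaObj R Y).d j i).hom (((P.complex.linearYonedaObj R Y).d k j).hom x)
      = 0 :=
  ((P.complex.linearYonedaObj R Y).sc' k j i).moduleCat_zero_apply x

/-- Ext as concrete homology -/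
noncomputable def extIso (P : ProjectiveResolution X) (Y : ModuleCat R) (i j k : ℕ)
    (hi : (ComplexShape.up ℕ).next j = i) (hk : (ComplexShape.up ℕ).prev j = k) :
    (LinearMap.ker ((P.complex.linearYonedaObj R Y).d j i).hom ⧸ LinearMap.range
      (((P.complex.linearYonedaObj R Y).d k j).hom.codRestrict
        (LinearMap.ker ((P.complex.linearYonedaObj R Y).d j i).hom)
        (YC_zero R P Y i j k))) ≃ₗ[R] (((Ext R (ModuleCat R) j).obj (Opposite.op X)).obj Y) :=
  (P.isoExt j Y ≪≫
    ShortComplex.homologyMapIso ((P.complex.linearYonedaObj R Y).isoSc' k j i hk hi) ≪≫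
    ((P.complex.linearYonedaObj R Y).sc' k j i).moduleCatHomologyIso).symm.toLinearEquiv

lemma tor_torsion (P : ProjectiveResolution X) (j : ℕ) :
    Module.IsTorsionBySet R ((TorF R I j).obj X) I := by
  intro x a
  let e := torIso R I P _ j _ rfl rfl
  apply e.symm.injective
  obtain ⟨y, hy⟩ := Submodule.mkQ_surjective _ (e.symm x)
  rw [map_smul, map_zero, ← hy, ← map_smul]
  have : (a : R) • y = 0 := by
    ext1
    change (a : R) • y.1 = 0
    rw [← algebraMap_smul (R ⧸ I) (a : R) y.1]
    have : algebraMap R (R ⧸ I) a = 0 := Ideal.Quotient.eq_zero_iff_mem.2 a.2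
    rw [this, zero_smul]
  rw [this, map_zero]

lemma exists_split (P : ProjectiveResolution X)
    (hfree : ∀ (k : ℕ),
      ∀ [Module (R ⧸ I) ((TorF R I k).obj X)]
        [IsScalarTower R (R ⧸ I) ((TorF R I k).obj X)],
      Module.Free (R ⧸ I) ((TorF R I k).obj X)) (j k : ℕ)
    (hk : (ComplexShape.down ℕ).next j = k) :
    ∃ t : (TC R I P).X k →ₗ[R] (TC R I P).X j,
      ∀ x, ((TC R I P).d j k).hom (t (((TC R I P).d j k).hom x)) = ((TC R I P).d j k).hom x := by
  induction j generalizing k with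
  | zero =>
    refine ⟨0, fun x => ?_⟩
    have : (TC R I P).d 0 k = 0 := (TC R I P).shape _ _ (by simp)
    rw [this]; simp
  | succ j ih =>
    obtain rfl : j = k := by rw [← hk]; simp
    obtain ⟨t, ht⟩ := ih _ rfl
    letI : Module (R ⧸ I) ((TorF R I j).obj X) := (tor_torsion R I P j).module
    haveI : IsScalarTower R (R ⧸ I) ((TorF R I j).obj X) := (tor_torsion R I P j).isScalarTower
    haveI := hfree j
    exact core1 (S := R ⧸ I) Ideal.Quotient.mk_surjective ((TC R I P).d (j+1) j).hom
      ((TC R I P).d j _).hom t ht (TC_zero R I P _ _ _) (torIso R I P _ j _ (by simp) rfl)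

end cat

/-- Let `r : Fin n → R` be a regular sequence generating the ideal `I`,
and let `A` be an `R`-module such that `Tor_k^R(R/I, A)` is a free `R/I`-module for every
`k ≥ 0`. Then for every `k ≥ 0` there is an isomorphism of `R/I`-modules
`Ext_R^k(A, R/I) ≅ Hom_{R/I}(Tor_k^R(R/I, A), R/I)`
(all `R/I`-module structures being the ones compatible with the `R`-module structures). -/
theorem stmt_11 (R : Type) [CommRing R] {n : ℕ} (r : Fin n → R)
    (hreg : RingTheory.Sequence.IsRegular R (List.ofFn r))
    (I : Ideal R) (hI : I = Ideal.span (Set.range r))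
    (A : Type) [AddCommGroup A] [Module R A]
    (hfree : ∀ (k : ℕ),
      ∀ [Module (R ⧸ I) ((TorF R I k).obj (ModuleCat.of R A))]
        [IsScalarTower R (R ⧸ I) ((TorF R I k).obj (ModuleCat.of R A))],
      Module.Free (R ⧸ I) ((TorF R I k).obj (ModuleCat.of R A)))
    (k : ℕ)
    [Module (R ⧸ I) ((TorF R I k).obj (ModuleCat.of R A))]
    [IsScalarTower R (R ⧸ I) ((TorF R I k).obj (ModuleCat.of R A))]
    [Module (R ⧸ I) (ExtM R k A (R ⧸ I))]
    [IsScalarTower R (R ⧸ I) (ExtM R k A (R ⧸ I))] :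
    Nonempty ((ExtM R k A (R ⧸ I)) ≃ₗ[R ⧸ I]
      (((TorF R I k).obj (ModuleCat.of R A)) →ₗ[R ⧸ I] (R ⧸ I))) := by
  have hS : Function.Surjective (algebraMap R (R ⧸ I)) := Ideal.Quotient.mk_surjective
  let P := projectiveResolution (ModuleCat.of R A)
  let Y := ModuleCat.of R (R ⧸ I)
  obtain ⟨m, hm⟩ : ∃ m, (ComplexShape.down ℕ).next k = m := ⟨_, rfl⟩
  obtain ⟨t, ht⟩ := exists_split R I P hfree k m hm
  have hm' : (ComplexShape.up ℕ).prev k = m := by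
    subst hm
    cases k <;> simp
  let T := torIso R I P (k+1) k m (by simp) hm
  let E := extIso R P Y (k+1) k m (by simp) hm'
  let eV : ∀ j, (P.complex.linearYonedaObj R Y).X j ≃ₗ[R] ((TC R I P).X j →ₗ[R] (R ⧸ I)) :=
    fun j => (ModuleCat.homLinearEquiv (S := R)).trans (LLe hS (P.complex.X j))
  have key : ∀ i j u, eV i (((P.complex.linearYonedaObj R Y).d j i).hom u) =
      eV j u ∘ₗ ((TC R I P).d i j).hom := by
    intro i j u
    exact LL_comp _ _
  obtain ⟨Φ⟩ := core2 (S := R ⧸ I) ((TC R I P).d (k+1) k).hom ((TC R I P).d k m).hom t ht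
    (TC_zero R I P _ _ _) ((P.complex.linearYonedaObj R Y).d m k).hom
    ((P.complex.linearYonedaObj R Y).d k (k+1)).hom (YC_zero R P Y _ _ _)
    (eV m) (eV k) (key _ _) (fun v => by
      rw [← key]; simp)
  let Ψ : (ExtM R k A (R ⧸ I)) ≃ₗ[R] (((TorF R I k).obj (ModuleCat.of R A)) →ₗ[R] (R ⧸ I)) :=
    E.symm.trans (Φ.trans (T.congrLeft (R ⧸ I) R))
  exact ⟨(Ψ.trans (LinearMap.extendScalarsOfSurjectiveEquiv hS)).extendScalarsOfSurjective hS⟩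
end

section
/- For all integers s ≥ 1 and k ≥ 0, the R/I-module Ext_R^k(R/I^s, R/I) is free. -/
open CategoryTheory

open Abelian in
theorem extMk_zero_imp {R : Type} [CommRing R] {X Y : ModuleCat.{0} R} (P : ProjectiveResolution X)
    (n : ℕ) (f : P.complex.X n ⟶ Y) (hf : P.complex.d (n+1) n ≫ f = 0) :
    P.extMk f (n+1) rfl hf = 0 ↔ ∃ g : (P.complex.linearYonedaObj R Y).X ((ComplexShape.up ℕ).prev n), (P.complex.linearYonedaObj R Y).d _ n g = f := by
  cases n with
  | succ p =>
    rw [P.extMk_eq_zero_iff f _ rfl hf p rfl]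
    have h : (ComplexShape.up ℕ).prev (p+1) = p := by simp
    rw [h]
    exact Iff.rfl
  | zero =>
    have h0 : (P.complex.linearYonedaObj R Y).d ((ComplexShape.up ℕ).prev 0) 0 = 0 :=
      HomologicalComplex.shape _ _ _ (by simp)
    rw [h0]
    simp only [ProjectiveResolution.extMk, CochainComplex.HomComplex.CohomologyClass.mk_eq_zero_iff, 
       ← P.extEquivCohomologyClass.apply_eq_iff_eq, Equiv.apply_symm_apply, ProjectiveResolution.extEquivCohomologyClass_zero]
    rw [CochainComplex.HomComplex.Cocycle.toSingleMk_mem_coboundaries_iff _ _ _ _ _ 1 (by simp)]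
    have hz : Limits.IsZero (P.cochainComplex.X 1) :=
      CochainComplex.isZero_of_isStrictlyLE _ 0 _
    constructor
    · rintro ⟨g, hg⟩
      refine ⟨0, ?_⟩
      rw [hz.eq_of_src g 0, Limits.comp_zero] at hg
      have : f = 0 := by
        rw [← cancel_epi (P.cochainComplexXIso _ 0 rfl).hom, ← hg, Limits.comp_zero]
      rw [this]
      rfl
    · rintro ⟨g, hg⟩
      have hf0 : f = 0 := hg.symm
      refine ⟨0, ?_⟩
      rw [hf0, Limits.comp_zero, Limits.comp_zero]

open Abelian in
theorem extcmp {R : Type} [CommRing R] (X Y : ModuleCat.{0} R) (n : ℕ) :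
    Nonempty (((Ext R (ModuleCat R) n).obj (Opposite.op X)).obj Y ≃ₗ[R] Abelian.Ext X Y n) := by
  let P := projectiveResolution X
  let S := (P.complex.linearYonedaObj R Y).sc n
  have hg : ∀ f : S.X₂, S.g f = 0 ↔ P.complex.d (n+1) n ≫ (show P.complex.X n ⟶ Y from f) = 0 := by
    intro f
    have h : (ComplexShape.up ℕ).next n = n+1 := by simp
    change (P.complex.linearYonedaObj R Y).d n ((ComplexShape.up ℕ).next n) f = 0 ↔ _
    rw [h]
    exact Iff.rfl
  let φ : LinearMap.ker S.g.hom →ₗ[R] Abelian.Ext X Y n :=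
    { toFun f := P.extMk (show P.complex.X n ⟶ Y from f.1) (n+1) rfl ((hg _).1 f.2)
      map_add' f g := by
        rw [P.add_extMk]; rfl
      map_smul' r f := by
        rw [RingHom.id_apply, Ext.smul_eq_comp_mk₀, P.extMk_comp_mk₀]
        congr 1 }
  have hsurj : Function.Surjective φ := by
    intro α
    obtain ⟨f, hf, h⟩ := P.extMk_surjective α (n+1) rfl
    exact ⟨⟨f, (hg _).2 hf⟩, h⟩
  have hker : LinearMap.ker φ = LinearMap.range S.moduleCatToCycles := by
    ext f
    rw [LinearMap.mem_ker]
    change P.extMk (show P.complex.X n ⟶ Y from f.1) (n+1) rfl ((hg _).1 f.2) = 0 ↔ _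
    rw [extMk_zero_imp]
    constructor
    · rintro ⟨g, h⟩
      exact ⟨g, Subtype.ext h⟩
    · rintro ⟨g, h⟩
      exact ⟨g, congrArg Subtype.val h⟩
  exact ⟨((P.isoExt n Y) ≪≫ S.moduleCatHomologyIso).toLinearEquiv ≪≫ₗ
    (Submodule.quotEquivOfEq _ _ hker.symm ≪≫ₗ φ.quotKerEquivOfSurjective hsurj)⟩

def FreeOver (R : Type) [CommRing R] (I : Ideal R) (E : Type) [AddCommGroup E] [Module R E] : Prop :=
  ∃ ι : Type, Nonempty (E ≃ₗ[R] (ι →₀ (R ⧸ I)))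

theorem FreeOver.of_equiv {R : Type} [CommRing R] {I : Ideal R} {A B : Type} [AddCommGroup A]
    [Module R A] [AddCommGroup B] [Module R B] (e : A ≃ₗ[R] B) (h : FreeOver R I A) :
    FreeOver R I B := by
  obtain ⟨ι, ⟨f⟩⟩ := h
  exact ⟨ι, ⟨e.symm ≪≫ₗ f⟩⟩

theorem FreeOver.of_ext {R : Type} [CommRing R] {I : Ideal R} {A B C : Type} [AddCommGroup A]
    [Module R A] [AddCommGroup B] [Module R B] [AddCommGroup C] [Module R C]
    (f : A →ₗ[R] B) (g : B →ₗ[R] C) (hf : Function.Injective f) (hfg : Function.Exact f g)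
    (hg : Function.Surjective g) (hB : ∀ a ∈ I, ∀ b : B, a • b = 0)
    (hA : FreeOver R I A) (hC : FreeOver R I C) : FreeOver R I B := by
  obtain ⟨ι, ⟨e₁⟩⟩ := hA
  obtain ⟨κ, ⟨e₂⟩⟩ := hC
  choose b hb using fun k : κ => hg (e₂.symm (Finsupp.single k 1))
  let σ : (κ →₀ (R ⧸ I)) →ₗ[R] B := Finsupp.lsum R (fun k =>
    Submodule.liftQ I (LinearMap.toSpanSingleton R B (b k)) (by
      intro a ha
      simpa using hB a ha _))
  have hσ : g ∘ₗ (σ ∘ₗ e₂.toLinearMap) = LinearMap.id := by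
    have : g ∘ₗ σ = e₂.symm.toLinearMap := by
      refine Finsupp.lhom_ext' fun k => ?_
      refine Submodule.linearMap_qext _ ?_
      ext
      have h1 : σ (Finsupp.single k (Submodule.Quotient.mk 1)) = b k := by
        rw [Finsupp.lsum_single, Submodule.liftQ_apply]
        simp
      change g (σ (Finsupp.single k (Submodule.Quotient.mk 1))) = e₂.symm (Finsupp.single k 1)
      rw [h1, hb]
    rw [← LinearMap.comp_assoc, this]
    ext; simp
  refine ⟨ι ⊕ κ, ⟨?_⟩⟩
  exact (hfg.splitSurjectiveEquiv hf ⟨_, hσ⟩).1 ≪≫ₗ (e₁.prodCongr e₂) ≪≫ₗ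
    (Finsupp.sumFinsuppLEquivProdFinsupp R).symm

open Abelian in
theorem ext_ann {R : Type} [CommRing R] {I : Ideal R} {X : ModuleCat.{0} R} {k : ℕ} {a : R} (ha : a ∈ I)
    (x : Abelian.Ext X (ModuleCat.of R (R ⧸ I)) k) : a • x = 0 := by
  have : a • 𝟙 (ModuleCat.of R (R ⧸ I)) = 0 := by
    ext
    simp
    change a • (Submodule.Quotient.mk 1 : R ⧸ I) = 0
    rw [← Submodule.Quotient.mk_smul, Submodule.Quotient.mk_eq_zero]
    simpa using ha
  rw [Ext.smul_eq_comp_mk₀, this]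
  simp

def Good (R : Type) [CommRing R] (I : Ideal R) (M : Type) [AddCommGroup M] [Module R M] : Prop :=
  ∀ k, FreeOver R I (Abelian.Ext (ModuleCat.of R M) (ModuleCat.of R (R ⧸ I)) k)

section
variable {R : Type} [CommRing R] {I : Ideal R} {A B C D E : Type} [AddCommGroup A]
    [Module R A] [AddCommGroup B] [Module R B] [AddCommGroup C] [Module R C] [AddCommGroup D]
    [Module R D] [AddCommGroup E] [Module R E]

abbrev mkS (f : A →ₗ[R] B) (g : B →ₗ[R] C) (hfg : Function.Exact f g) : ShortComplex (ModuleCat.{0} R) :=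
  ShortComplex.mk (ModuleCat.ofHom f) (ModuleCat.ofHom g) (by
    ext x; simpa using (hfg _).2 ⟨x, rfl⟩)

theorem mkS_exact (f : A →ₗ[R] B) (g : B →ₗ[R] C) (hfg : Function.Exact f g)
    (hf : Function.Injective f) (hg : Function.Surjective g) : (mkS f g hfg).ShortExact :=
  ModuleCat.shortComplex_shortExact _ hfg hf hg

open Abelian

theorem good_ext (f : A →ₗ[R] B) (g : B →ₗ[R] C) (hfg : Function.Exact f g)
    (hf : Function.Injective f) (hg : Function.Surjective g)
    (f' : D →ₗ[R] E) (g' : E →ₗ[R] C) (hfg' : Function.Exact f' g')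
    (hf' : Function.Injective f') (hg' : Function.Surjective g')
    (u : D →ₗ[R] A) (v : E →ₗ[R] B) (a : R) (ha : a ∈ I)
    (h1 : f ∘ₗ (a • u) = v ∘ₗ f') (h2 : g ∘ₗ v = g')
    (hA : Good R I A) (hC : Good R I C) : Good R I B := by
  intro k
  have hS := mkS_exact f g hfg hf hg
  have hS' := mkS_exact f' g' hfg' hf' hg'
  let φ : mkS f' g' hfg' ⟶ mkS f g hfg :=
    { τ₁ := ModuleCat.ofHom (a • u)
      τ₂ := ModuleCat.ofHom v
      τ₃ := 𝟙 _
      comm₁₂ := by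
        ext x; exact LinearMap.congr_fun h1 x
      comm₂₃ := by
        ext x; simpa using LinearMap.congr_fun h2 x }
  have hδ : ∀ (k : ℕ) (x : Abelian.Ext (ModuleCat.of R A) (ModuleCat.of R (R ⧸ I)) k),
      hS.extClass.comp x (add_comm 1 k) = 0 := by
    intro k x
    have h := ShortComplex.ShortExact.extClass_naturality hS' hS φ
    have e1 : (Ext.mk₀ φ.τ₁) = a • Ext.mk₀ (ModuleCat.ofHom u) := by
      rw [← Ext.mk₀_smul]; rfl
    have e2 : (Ext.mk₀ φ.τ₃).comp hS.extClass (zero_add 1) = hS.extClass := Ext.mk₀_id_comp _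
    rw [e1, e2] at h
    rw [← h, Ext.comp_smul, Ext.smul_comp]
    exact ext_ann ha _
  refine FreeOver.of_ext ((Ext.mk₀ (mkS f g hfg).g).precompOfLinear R _ (zero_add k))
    ((Ext.mk₀ (mkS f g hfg).f).precompOfLinear R _ (zero_add k)) ?_ ?_ ?_ ?_ (hC k) (hA k)
  · rw [← LinearMap.ker_eq_bot, Submodule.eq_bot_iff]
    intro x hx
    cases k with
    | zero =>
      have : Epi (mkS f g hfg).g := hS.epi_g
      exact Ext.precomp_mk₀_injective_of_epi _ (mkS f g hfg).g (by simpa using hx)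
    | succ k =>
      obtain ⟨y, rfl⟩ := Ext.contravariant_sequence_exact₃ hS _ x hx (add_comm 1 k)
      exact hδ k y
  · intro x
    constructor
    · intro hx
      exact Ext.contravariant_sequence_exact₂ hS _ x hx
    · rintro ⟨y, rfl⟩
      change (Ext.mk₀ (mkS f g hfg).f).comp ((Ext.mk₀ (mkS f g hfg).g).comp y (zero_add k)) (zero_add k) = 0
      rw [Ext.mk₀_comp_mk₀_assoc, ShortComplex.zero]
      simp
  · intro x
    exact Ext.contravariant_sequence_exact₁ hS _ x (add_comm 1 k) (hδ k x)
  · intro b hb x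
    exact ext_ann hb x

theorem good_coker (f : A →ₗ[R] B) (g : B →ₗ[R] C) (hfg : Function.Exact f g)
    (hf : Function.Injective f) (hg : Function.Surjective g)
    (u : A →ₗ[R] B) (a : R) (ha : a ∈ I) (h1 : f = a • u)
    (hA : Good R I A) (hB : Good R I B) : Good R I C := by
  have hS := mkS_exact f g hfg hf hg
  have h0 : ∀ (k : ℕ) (x : Abelian.Ext (ModuleCat.of R B) (ModuleCat.of R (R ⧸ I)) k),
      (Ext.mk₀ (mkS f g hfg).f).comp x (zero_add k) = 0 := by
    intro k x
    have e1 : (Ext.mk₀ (mkS f g hfg).f) = a • Ext.mk₀ (ModuleCat.ofHom u) := by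
      rw [← Ext.mk₀_smul]; subst h1; rfl
    rw [e1, Ext.smul_comp]
    exact ext_ann ha _
  intro k
  cases k with
  | zero =>
    refine (hB 0).of_equiv (LinearEquiv.symm (LinearEquiv.ofBijective
      ((Ext.mk₀ (mkS f g hfg).g).precompOfLinear R _ (zero_add 0)) ⟨?_, ?_⟩))
    · have : Epi (mkS f g hfg).g := hS.epi_g
      exact Ext.precomp_mk₀_injective_of_epi _ (mkS f g hfg).g
    · intro x
      exact Ext.contravariant_sequence_exact₂ hS _ x (h0 0 x)
  | succ k =>
    refine FreeOver.of_ext (hS.extClass.precompOfLinear R _ (add_comm 1 k))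
      ((Ext.mk₀ (mkS f g hfg).g).precompOfLinear R _ (zero_add (k+1))) ?_ ?_ ?_ ?_ (hA k) (hB (k+1))
    · rw [← LinearMap.ker_eq_bot, Submodule.eq_bot_iff]
      intro x hx
      obtain ⟨y, rfl⟩ := Ext.contravariant_sequence_exact₁ hS _ x (add_comm 1 k) hx
      exact h0 k y
    · intro x
      constructor
      · intro hx
        exact Ext.contravariant_sequence_exact₃ hS _ x hx (add_comm 1 k)
      · rintro ⟨y, rfl⟩
        exact hS.comp_extClass_assoc y (add_comm 1 k)
    · intro x
      exact Ext.contravariant_sequence_exact₂ hS _ x (h0 _ x)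
    · intro b hb x
      exact ext_ann hb x

theorem good_equiv (e : A ≃ₗ[R] B) (h : Good R I A) : Good R I B := by
  intro k
  let e' : ModuleCat.of R A ≅ ModuleCat.of R B := e.toModuleIso
  refine (h k).of_equiv (LinearEquiv.symm (LinearEquiv.ofLinearMap
    ((Ext.mk₀ e'.hom).precompOfLinear R _ (zero_add k))
    ((Ext.mk₀ e'.inv).precompOfLinear R _ (zero_add k)) ?_ ?_))
  · ext x
    simp
  · ext x
    simp

theorem good_zero [Subsingleton A] : Good R I A := by
  intro k
  have hz : ModuleCat.ofHom (LinearMap.id : A →ₗ[R] A) = 0 := by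
    ext x; exact Subsingleton.elim _ _
  have : Subsingleton (Abelian.Ext (ModuleCat.of R A) (ModuleCat.of R (R ⧸ I)) k) := by
    refine ⟨fun x y => ?_⟩
    rw [← Ext.mk₀_id_comp x, ← Ext.mk₀_id_comp y]
    change (Ext.mk₀ (ModuleCat.ofHom (LinearMap.id : A →ₗ[R] A))).comp x _ = 
      (Ext.mk₀ (ModuleCat.ofHom (LinearMap.id : A →ₗ[R] A))).comp y _
    rw [hz]; simp
  exact ⟨PEmpty, ⟨LinearEquiv.ofSubsingleton _ _⟩⟩

theorem good_prod (hA : Good R I A) (hB : Good R I B) : Good R I (A × B) := by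
  refine good_ext (A := A) (C := B) (D := A) (E := A × B) (LinearMap.inl R A B) (LinearMap.snd R A B)
    ?_ LinearMap.inl_injective LinearMap.snd_surjective (LinearMap.inl R A B) (LinearMap.snd R A B)
    ?_ LinearMap.inl_injective LinearMap.snd_surjective 0
    (LinearMap.inr R A B ∘ₗ LinearMap.snd R A B) 0 I.zero_mem ?_ ?_ hA hB
  · exact Function.Exact.inl_snd
  · exact Function.Exact.inl_snd
  · ext <;> simp
  · ext <;> simp

theorem good_pi (hA : Good R I A) : ∀ n : ℕ, Good R I (Fin n → A)
  | 0 => good_zero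
  | n+1 => good_equiv (Fin.consLinearEquiv R (fun _ : Fin (n+1) => A)) (good_prod hA (good_pi hA n))

theorem good_ring : Good R I R := by
  intro k
  cases k with
  | zero =>
    refine FreeOver.of_equiv (A := R ⧸ I) ?_ ⟨PUnit, ⟨(Finsupp.uniqueLinearEquiv R (R ⧸ I) PUnit.unit).symm⟩⟩
    exact ((Ext.linearEquiv₀ (R := R)).trans (ModuleCat.homLinearEquiv (S := R)) |>.trans
      (LinearMap.ringLmapEquivSelf R R _)).symm
  | succ k =>
    have : Subsingleton (Abelian.Ext (ModuleCat.of R R) (ModuleCat.of R (R ⧸ I)) (k+1)) := by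
      exact ⟨fun x y => (Ext.eq_zero_of_projective x).trans (Ext.eq_zero_of_projective y).symm⟩
    exact ⟨PEmpty, ⟨LinearEquiv.ofSubsingleton _ _⟩⟩

end

section CA
variable {R : Type} [CommRing R]

/-- The subquotient `L / (K ∩ L)`. -/
abbrev SQ (L K : Ideal R) : Type := L ⧸ (Submodule.comap L.subtype K)

/-- Multiplication by `a` between subquotients. -/
def mm {L K L' K' : Ideal R} (a : R) (h1 : ∀ x ∈ L, a * x ∈ L')
    (h2 : ∀ x ∈ L, x ∈ K → a * x ∈ K') : SQ L K →ₗ[R] SQ L' K' :=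
  Submodule.mapQ _ _ (((a • LinearMap.id : R →ₗ[R] R)).restrict (p := L) (q := L')
    (fun x hx => by simpa using h1 x hx)) (fun x hx => by simpa using h2 x.1 x.2 hx)

theorem mm_mk {L K L' K' : Ideal R} (a : R) (h1 : ∀ x ∈ L, a * x ∈ L')
    (h2 : ∀ x ∈ L, x ∈ K → a * x ∈ K') (x : R) (hx : x ∈ L) :
    mm (K := K) (K' := K') a h1 h2 (Submodule.Quotient.mk ⟨x, hx⟩) =
      Submodule.Quotient.mk ⟨a * x, h1 x hx⟩ := rfl

theorem SQ_zero {L K : Ideal R} (x : R) (hx : x ∈ L) :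
    (Submodule.Quotient.mk ⟨x, hx⟩ : SQ L K) = 0 ↔ x ∈ K := by
  rw [Submodule.Quotient.mk_eq_zero]; rfl

theorem SQ_eq {L K : Ideal R} (x y : R) (hx : x ∈ L) (hy : y ∈ L) :
    (Submodule.Quotient.mk ⟨x, hx⟩ : SQ L K) = Submodule.Quotient.mk ⟨y, hy⟩ ↔ x - y ∈ K := by
  rw [Submodule.Quotient.eq]; rfl

theorem SQ_surj {L K : Ideal R} (z : SQ L K) : ∃ x, ∃ hx : x ∈ L, z = Submodule.Quotient.mk ⟨x, hx⟩ := by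
  obtain ⟨⟨x, hx⟩, rfl⟩ := Submodule.Quotient.mk_surjective _ z
  exact ⟨x, hx, rfl⟩

theorem mm_inj {L K L' K' : Ideal R} (a : R) (h1 : ∀ x ∈ L, a * x ∈ L')
    (h2 : ∀ x ∈ L, x ∈ K → a * x ∈ K') (h : ∀ x ∈ L, a * x ∈ K' → x ∈ K) :
    Function.Injective (mm (K := K) (K' := K') a h1 h2) := by
  rw [← LinearMap.ker_eq_bot, Submodule.eq_bot_iff]
  intro z hz
  obtain ⟨x, hx, rfl⟩ := SQ_surj z
  rw [LinearMap.mem_ker, mm_mk, SQ_zero] at hz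
  exact (SQ_zero _ _).2 (h x hx hz)

theorem mm_surj {L K L' K' : Ideal R} (a : R) (h1 : ∀ x ∈ L, a * x ∈ L')
    (h2 : ∀ x ∈ L, x ∈ K → a * x ∈ K') (h : ∀ y ∈ L', ∃ x ∈ L, y - a * x ∈ K') :
    Function.Surjective (mm (K := K) (K' := K') a h1 h2) := by
  intro z
  obtain ⟨y, hy, rfl⟩ := SQ_surj z
  obtain ⟨x, hx, hxy⟩ := h y hy
  refine ⟨Submodule.Quotient.mk ⟨x, hx⟩, ?_⟩
  rw [mm_mk]
  exact ((SQ_eq _ _ _ _).2 hxy).symm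

theorem mm_exact {L K L' K' L'' K'' : Ideal R} (a b : R) (h1 : ∀ x ∈ L, a * x ∈ L')
    (h2 : ∀ x ∈ L, x ∈ K → a * x ∈ K') (h3 : ∀ x ∈ L', b * x ∈ L'')
    (h4 : ∀ x ∈ L', x ∈ K' → b * x ∈ K'')
    (h : ∀ x ∈ L, b * (a * x) ∈ K'')
    (h' : ∀ y ∈ L', b * y ∈ K'' → ∃ x ∈ L, y - a * x ∈ K') :
    Function.Exact (mm (K := K) (K' := K') a h1 h2) (mm (K := K') (K' := K'') b h3 h4) := by
  intro z
  obtain ⟨y, hy, rfl⟩ := SQ_surj z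
  rw [mm_mk, SQ_zero]
  constructor
  · intro hb
    obtain ⟨x, hx, hxy⟩ := h' y hy hb
    refine ⟨Submodule.Quotient.mk ⟨x, hx⟩, ?_⟩
    rw [mm_mk]
    exact ((SQ_eq _ _ _ _).2 hxy).symm
  · rintro ⟨w, hw⟩
    obtain ⟨x, hx, rfl⟩ := SQ_surj w
    rw [mm_mk, SQ_eq] at hw
    have := h4 _ (L'.sub_mem (h1 x hx) hy) hw
    have h5 := K''.sub_mem (h x hx) this
    convert h5 using 1
    ring

theorem pow_dec (K L : Ideal R) (x : R) (hL : L = K ⊔ Ideal.span {x}) (s : ℕ) :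
    L ^ (s+1) = K ^ (s+1) ⊔ Ideal.span {x} * L ^ s := by
  induction s with
  | zero => simp [hL]
  | succ s ih =>
    have hKL : K ≤ L := hL ▸ le_sup_left
    have hxL : Ideal.span {x} ≤ L := hL ▸ le_sup_right
    apply le_antisymm
    · have e : L ^ (s+1+1) = L ^ (s+1) * K ⊔ L ^ (s+1) * Ideal.span {x} := by
        rw [← Ideal.mul_sup, ← hL, pow_succ]
      rw [e]
      refine sup_le ?_ ?_
      · conv_lhs => rw [ih]
        rw [Ideal.sup_mul, ← pow_succ]
        refine sup_le_sup le_rfl ?_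
        rw [mul_assoc, pow_succ L s]
        exact Ideal.mul_mono le_rfl (Ideal.mul_mono le_rfl hKL)
      · rw [mul_comm]; exact le_sup_right
    · refine sup_le (Ideal.pow_right_mono hKL _) ?_
      rw [pow_succ' L (s+1)]
      exact Ideal.mul_mono hxL le_rfl

theorem mem_pow_dec (K L : Ideal R) (x : R) (hL : L = K ⊔ Ideal.span {x}) (s : ℕ) (y : R) :
    y ∈ L ^ (s+1) ↔ ∃ c ∈ K ^ (s+1), ∃ d ∈ L ^ s, y = c + x * d := by
  rw [pow_dec K L x hL, Submodule.mem_sup]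
  constructor
  · rintro ⟨c, hc, e, he, rfl⟩
    obtain ⟨d, hd, rfl⟩ := Ideal.mem_span_singleton_mul.1 he
    exact ⟨c, hc, d, hd, rfl⟩
  · rintro ⟨c, hc, d, hd, rfl⟩
    exact ⟨c, hc, _, Ideal.mem_span_singleton_mul.2 ⟨d, hd, rfl⟩, rfl⟩

/-- `K^s/K^(s+1)` is free over `R/K`. -/
def QR (K : Ideal R) (s : ℕ) : Prop :=
  ∃ (ι : Type) (_ : Fintype ι) (u : ι → R), (∀ i, u i ∈ K ^ s) ∧
    (∀ y ∈ K ^ s, ∃ c : ι → R, y - ∑ i, c i * u i ∈ K ^ (s+1)) ∧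
    (∀ c : ι → R, ∑ i, c i * u i ∈ K ^ (s+1) → ∀ i, c i ∈ K)

theorem QR_zero (K : Ideal R) : QR K 0 := by
  refine ⟨Unit, inferInstance, fun _ => 1, by simp, fun y _ => ⟨fun _ => y, by simp⟩, ?_⟩
  intro c hc i
  simpa using hc

theorem QR_bot (s : ℕ) : QR (⊥ : Ideal R) s := by
  cases s with
  | zero => exact QR_zero _
  | succ s =>
    refine ⟨Empty, inferInstance, fun _ => 1, by simp, fun y hy => ⟨fun _ => y, ?_⟩, ?_⟩
    · have : y = 0 := by
        rw [pow_succ] at hy; simpa using hy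
      simp [this]
    · intro c hc i; exact i.elim

theorem nzd_pow (K : Ideal R) (x : R) (hx : ∀ y, x * y ∈ K → y ∈ K) (hQ : ∀ s, QR K s) (s : ℕ) :
    ∀ y, x * y ∈ K ^ s → y ∈ K ^ s := by
  induction s with
  | zero => simp
  | succ s ih =>
    intro y hy
    have h1 := ih y (Ideal.pow_le_pow_right (Nat.le_succ s) hy)
    obtain ⟨ι, _, u, hu, hspan, hind⟩ := hQ s
    obtain ⟨c, hc⟩ := hspan y h1
    have h2 : ∑ i, (x * c i) * u i ∈ K ^ (s+1) := by
      have := Ideal.sub_mem _ hy (Ideal.mul_mem_left _ x hc)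
      convert this using 1
      rw [mul_sub, Finset.mul_sum]
      simp [mul_assoc]
    have h3 := hind _ h2
    have h4 : ∑ i, c i * u i ∈ K ^ (s+1) := by
      refine Ideal.sum_mem _ fun i _ => ?_
      rw [pow_succ']
      exact Ideal.mul_mem_mul (hx _ (h3 i)) (hu i)
    simpa using Ideal.add_mem _ hc h4

theorem QR_step (K L : Ideal R) (x : R) (hL : L = K ⊔ Ideal.span {x})
    (hx : ∀ y, x * y ∈ K → y ∈ K) (hQ : ∀ s, QR K s) (s : ℕ) : QR L s := by
  have hKL : K ≤ L := hL ▸ le_sup_left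
  have hxL : x ∈ L := (hL ▸ le_sup_right : Ideal.span {x} ≤ L) (Ideal.mem_span_singleton_self x)
  induction s with
  | zero => exact QR_zero L
  | succ s ih =>
    obtain ⟨ι, _, u, hu, hspan, hind⟩ := hQ (s+1)
    obtain ⟨κ, _, v, hv, hspan', hind'⟩ := ih
    refine ⟨ι ⊕ κ, inferInstance, Sum.elim u (fun k => x * v k), ?_, ?_, ?_⟩
    · rintro (i | k)
      · exact Ideal.pow_right_mono hKL _ (hu i)
      · simp only [Sum.elim_inr]
        rw [pow_succ']
        exact Ideal.mul_mem_mul hxL (hv k)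
    · intro y hy
      obtain ⟨c, hc, d, hd, rfl⟩ := (mem_pow_dec K L x hL s y).1 hy
      obtain ⟨c1, h1⟩ := hspan c hc
      obtain ⟨c2, h2⟩ := hspan' d hd
      refine ⟨Sum.elim c1 c2, ?_⟩
      refine (mem_pow_dec K L x hL (s+1) _).2 ⟨_, h1, _, h2, ?_⟩
      simp [Fintype.sum_sum_type, mul_sub, Finset.mul_sum, mul_left_comm]
      ring
    · intro c hc
      simp only [Fintype.sum_sum_type, Sum.elim_inl, Sum.elim_inr] at hc
      obtain ⟨e, he, f, hf, hef⟩ := (mem_pow_dec K L x hL (s+1) _).1 hc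
      set a := ∑ i, c (Sum.inl i) * u i with ha
      set b := ∑ k, c (Sum.inr k) * v k with hb
      have hab : a + x * b = e + x * f := by
        rw [← hef, hb, Finset.mul_sum]
        simp [mul_left_comm]
      have haK : a ∈ K ^ (s+1) := Ideal.sum_mem _ fun i _ => Ideal.mul_mem_left _ _ (hu i)
      have hw : b - f ∈ K ^ (s+1) := by
        apply nzd_pow K x hx hQ
        have : x * (b - f) = e - a := by linear_combination hab
        rw [this]
        exact Ideal.sub_mem _ (Ideal.pow_le_pow_right (Nat.le_succ _) he) haK
      have hbL : b ∈ L ^ (s+1) := by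
        have := Ideal.add_mem _ (Ideal.pow_right_mono hKL _ hw) hf
        simpa using this
      have hc2 := hind' _ hbL
      obtain ⟨g, hg⟩ := hspan _ hw
      have h3 : ∑ i, (c (Sum.inl i) + x * g i) * u i ∈ K ^ (s+1+1) := by
        have := Ideal.sub_mem _ he (Ideal.mul_mem_left _ x hg)
        convert this using 1
        have e1 : ∑ i, (c (Sum.inl i) + x * g i) * u i = a + x * ∑ i, g i * u i := by
          rw [ha, Finset.mul_sum, ← Finset.sum_add_distrib]
          exact Finset.sum_congr rfl fun i _ => by ring
        rw [e1]
        linear_combination hab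
      have hc1 := hind _ h3
      rintro (i | k)
      · have h4 := Ideal.sub_mem _ (hKL (hc1 i)) (Ideal.mul_mem_right (g i) _ hxL)
        simpa using h4
      · exact hc2 k

/-- `R/K` as a subquotient. -/
def SQtop (K : Ideal R) : (R ⧸ K) ≃ₗ[R] SQ (⊤ : Ideal R) K :=
  LinearEquiv.symm (Submodule.Quotient.equiv _ _ Submodule.topEquiv (by
    ext x
    simp [Submodule.mem_map]))

theorem good_D {I : Ideal R} (K : Ideal R) (s : ℕ) (hQ : QR K s) (hK : Good R I (R ⧸ K)) :
    Good R I (SQ (K ^ s) (K ^ (s+1))) := by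
  obtain ⟨ι, _, u, hu, hspan, hind⟩ := hQ
  have hgood : Good R I (ι → R ⧸ K) :=
    good_equiv (LinearEquiv.funCongrLeft R (R ⧸ K) (Fintype.equivFin ι)) (good_pi hK _)
  let φ : (ι → R) →ₗ[R] (K ^ s : Ideal R) :=
    ∑ i, (LinearMap.toSpanSingleton R (K ^ s : Ideal R) ⟨u i, hu i⟩) ∘ₗ LinearMap.proj i
  have hφ : ∀ c, (φ c : R) = ∑ i, c i * u i := by
    intro c
    simp [φ]
  let ψ : (ι → R) →ₗ[R] SQ (K ^ s) (K ^ (s+1)) := Submodule.mkQ _ ∘ₗ φ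
  let π : (ι → R) →ₗ[R] (ι → R ⧸ K) := LinearMap.pi fun i => Submodule.mkQ K ∘ₗ LinearMap.proj i
  have hψs : Function.Surjective ψ := by
    intro z
    obtain ⟨y, hy, rfl⟩ := SQ_surj z
    obtain ⟨c, hc⟩ := hspan y hy
    refine ⟨c, ?_⟩
    symm
    refine (Submodule.Quotient.eq _).2 ?_
    change y - (φ c : R) ∈ K ^ (s+1)
    rwa [hφ]
  have hπs : Function.Surjective π := by
    intro z
    choose c hc using fun i => Submodule.Quotient.mk_surjective K (z i)
    exact ⟨c, funext hc⟩
  have hker : LinearMap.ker π = LinearMap.ker ψ := by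
    ext c
    have e1 : ψ c = 0 ↔ ∑ i, c i * u i ∈ K ^ (s+1) := by
      rw [← hφ]
      exact Submodule.Quotient.mk_eq_zero _
    have e2 : π c = 0 ↔ ∀ i, c i ∈ K := by
      rw [funext_iff]
      exact forall_congr' fun i => Submodule.Quotient.mk_eq_zero _
    rw [LinearMap.mem_ker, LinearMap.mem_ker, e1, e2]
    constructor
    · intro h
      refine Ideal.sum_mem _ fun i _ => ?_
      rw [pow_succ']
      exact Ideal.mul_mem_mul (h i) (hu i)
    · exact hind c
  exact good_equiv ((π.quotKerEquivOfSurjective hπs).symm ≪≫ₗ Submodule.quotEquivOfEq _ _ hker ≪≫ₗ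
    ψ.quotKerEquivOfSurjective hψs) hgood

theorem good_A {I : Ideal R} (K L : Ideal R) (x : R) (hL : L = K ⊔ Ideal.span {x}) (hxI : x ∈ I)
    (hn : ∀ s y, x * y ∈ K ^ s → y ∈ K ^ s) (hQ : ∀ s, QR K s)
    (hK : Good R I (SQ ⊤ (K ^ 1))) (s : ℕ) : Good R I (SQ (L ^ s) (K ^ (s+1))) := by
  have hKL : K ≤ L := hL ▸ le_sup_left
  have hxL : x ∈ L := (hL ▸ le_sup_right : Ideal.span {x} ≤ L) (Ideal.mem_span_singleton_self x)
  have hxp : ∀ s, ∀ y ∈ L ^ s, x * y ∈ L ^ (s+1) := fun s y hy => by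
    rw [pow_succ']; exact Ideal.mul_mem_mul hxL hy
  have hKp : ∀ s, ∀ y ∈ K ^ s, y ∈ L ^ s := fun s y hy => Ideal.pow_right_mono hKL _ hy
  have hKs : ∀ s, ∀ y ∈ K ^ (s+1), y ∈ K ^ s := fun s y hy => Ideal.pow_le_pow_right (Nat.le_succ s) hy
  have hLs : ∀ s, ∀ y ∈ L ^ (s+1), y ∈ L ^ s := fun s y hy => Ideal.pow_le_pow_right (Nat.le_succ s) hy
  induction s with
  | zero =>
    have : L ^ 0 = ⊤ := by simp
    rw [this]; exact hK
  | succ s ih =>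
    have hD : Good R I (SQ (K ^ (s+1)) (K ^ (s+1+1))) := good_D K (s+1) (hQ _) (by
      rw [pow_one] at hK
      exact good_equiv (SQtop K).symm hK)
    have hsur : ∀ y ∈ L ^ (s+1), ∃ z ∈ L ^ s, y - x * z ∈ K ^ (s+1) := by
      intro y hy
      obtain ⟨c, hc, d, hd, rfl⟩ := (mem_pow_dec K L x hL s y).1 hy
      exact ⟨d, hd, by simpa using hc⟩
    have hC : Good R I (SQ (L ^ (s+1)) (K ^ (s+1))) := by
      refine good_equiv (LinearEquiv.ofBijective (mm (L := L ^ s) (K := K ^ (s+1)) x (hxp s)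
        (fun y _ hy => Ideal.mul_mem_left _ _ hy)) ⟨?_, ?_⟩) ih
      · exact mm_inj _ _ _ fun y _ hy => hn _ y hy
      · exact mm_surj _ _ _ hsur
    refine good_ext (A := SQ (K ^ (s+1)) (K ^ (s+1+1))) (C := SQ (L ^ (s+1)) (K ^ (s+1)))
      (D := SQ (K ^ (s+1)) (K ^ (s+1+1))) (E := SQ (L ^ s) (K ^ (s+1+1)))
      (mm 1 (fun y hy => by simpa using hKp _ y hy) (fun y _ hy => by simpa using hy))
      (mm 1 (fun y hy => by simpa using hy) (fun y _ hy => by simpa using hKs _ y hy))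
      (mm_exact _ _ _ _ _ _ (fun y hy => by simpa using hy)
        (fun y hy h => ⟨y, by simpa using h, by simp⟩))
      (mm_inj _ _ _ (fun y _ h => by simpa using h))
      (mm_surj _ _ _ (fun y hy => ⟨y, hy, by simp⟩))
      (mm 1 (fun y hy => by simpa using hLs _ _ (hKp _ y hy)) (fun y _ hy => by simpa using hy))
      (mm x (hxp s) (fun y _ hy => Ideal.mul_mem_left _ _ (hKs _ y hy)))
      (mm_exact _ _ _ _ _ _ (fun y hy => Ideal.mul_mem_left _ _ (by simpa using hy))
        (fun y hy h => ⟨y, hn _ _ h, by simp⟩))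
      (mm_inj _ _ _ (fun y _ h => by simpa using h))
      (mm_surj _ _ _ hsur)
      LinearMap.id
      (mm x (hxp s) (fun y _ hy => Ideal.mul_mem_left _ _ hy)) x hxI ?_ ?_ hD hC
    · refine LinearMap.ext fun z => ?_
      obtain ⟨y, hy, rfl⟩ := SQ_surj z
      simp only [LinearMap.comp_apply, LinearMap.smul_apply, LinearMap.id_apply, map_smul, mm_mk]
      rw [← Submodule.Quotient.mk_smul]
      rfl
    · refine LinearMap.ext fun z => ?_
      obtain ⟨y, hy, rfl⟩ := SQ_surj z
      simp only [LinearMap.comp_apply, mm_mk]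
      refine (SQ_eq _ _ _ _).2 ?_
      simp

theorem good_H_step {I : Ideal R} (K L : Ideal R) (x : R) (hL : L = K ⊔ Ideal.span {x}) (hxI : x ∈ I)
    (hn : ∀ s y, x * y ∈ K ^ s → y ∈ K ^ s) (hQ : ∀ s, QR K s)
    (hK : ∀ s, Good R I (SQ ⊤ (K ^ (s+1)))) (s : ℕ) : Good R I (SQ ⊤ (L ^ (s+1))) := by
  have hKL : K ≤ L := hL ▸ le_sup_left
  refine good_coker (A := SQ (L ^ s) (K ^ (s+1))) (B := SQ ⊤ (K ^ (s+1)))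
    (mm x (by simp) (fun y _ hy => Ideal.mul_mem_left _ _ hy))
    (mm 1 (by simp) (fun y _ hy => by simpa using Ideal.pow_right_mono hKL _ hy))
    (mm_exact _ _ _ _ _ _ (fun y hy => by
        rw [one_mul]
        exact (mem_pow_dec K L x hL s _).2 ⟨0, Ideal.zero_mem _, y, hy, by simp⟩)
      (fun y _ hy => by
        rw [one_mul] at hy
        obtain ⟨c, hc, d, hd, rfl⟩ := (mem_pow_dec K L x hL s y).1 hy
        exact ⟨d, hd, by simpa using hc⟩))
    (mm_inj _ _ _ (fun y _ h => hn _ _ h))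
    (mm_surj _ _ _ (fun y hy => ⟨y, hy, by simp⟩))
    (mm 1 (by simp) (fun y _ hy => by simpa using hy)) x hxI ?_
    (good_A K L x hL hxI hn hQ (hK 0) s) (hK s)
  refine LinearMap.ext fun z => ?_
  obtain ⟨y, hy, rfl⟩ := SQ_surj z
  simp only [LinearMap.smul_apply, mm_mk]
  rw [← Submodule.Quotient.mk_smul]
  refine (SQ_eq _ _ _ _).2 ?_
  simp

theorem good_main {I : Ideal R} (J : ℕ → Ideal R) (x : ℕ → R) (n : ℕ) (h0 : J 0 = ⊥)
    (hJ : ∀ m < n, J (m+1) = J m ⊔ Ideal.span {x m}) (hxI : ∀ m < n, x m ∈ I)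
    (hreg : ∀ m < n, ∀ y, x m * y ∈ J m → y ∈ J m) :
    ∀ m ≤ n, (∀ s, QR (J m) s) ∧ ∀ s, Good R I (SQ ⊤ (J m ^ (s+1))) := by
  intro m
  induction m with
  | zero =>
    intro _
    rw [h0]
    refine ⟨QR_bot, fun s => ?_⟩
    have : (⊥ : Ideal R) ^ (s+1) = ⊥ := by rw [pow_succ]; simp
    rw [this]
    exact good_equiv ((Submodule.quotEquivOfEqBot _ rfl).symm ≪≫ₗ SQtop ⊥) good_ring
  | succ m ih =>
    intro hm
    obtain ⟨h1, h2⟩ := ih (by omega)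
    exact ⟨QR_step _ _ _ (hJ m hm) (hreg m hm) h1,
      good_H_step _ _ _ (hJ m hm) (hxI m hm) (nzd_pow _ _ (hreg m hm) h1) h1 h2⟩

theorem good_final {n : ℕ} (r : Fin n → R)
    (hreg : RingTheory.Sequence.IsRegular R (List.ofFn r))
    (I : Ideal R) (hI : I = Ideal.span (Set.range r)) (s : ℕ) (hs : 1 ≤ s) :
    Good R I (R ⧸ I ^ s) := by
  set l := List.ofFn r with hl
  have hlen : l.length = n := by simp [hl]
  have hIl : Ideal.ofList l = I := by
    rw [hI, Ideal.ofList]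
    congr 1
    ext y
    simp [hl, List.mem_ofFn]
  have hmem : ∀ m (h : m < n), l[m]'(by omega) ∈ I := by
    intro m h
    rw [← hIl]
    exact Ideal.subset_span (List.getElem_mem _)
  have key := good_main (I := I) (fun m => Ideal.ofList (l.take m)) (fun m => l.getD m 0) n
    (by simp) (fun m hm => by
      have : m < l.length := by omega
      simp only [List.take_succ_eq_append_getElem this, Ideal.ofList_append, Ideal.ofList_singleton]
      rw [List.getD_eq_getElem _ _ this])
    (fun m hm => by
      have : m < l.length := by omega
      rw [List.getD_eq_getElem _ _ this]
      exact hmem m hm)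
    (fun m hm y hy => by
      have : m < l.length := by omega
      rw [List.getD_eq_getElem _ _ this] at hy
      have h := hreg.toIsWeaklyRegular.regular_mod_prev m this
      have hz : (l[m] • (Submodule.Quotient.mk y : R ⧸ (Ideal.ofList (l.take m) • ⊤ : Submodule R R))) = l[m] • 0 := by
        rw [smul_zero, ← Submodule.Quotient.mk_smul, Submodule.Quotient.mk_eq_zero]
        simpa using hy
      have := h hz
      rw [Submodule.Quotient.mk_eq_zero] at this
      simpa using this) n le_rfl
  have h2 : Good R I (SQ ⊤ (Ideal.ofList (l.take n) ^ (s - 1 + 1))) := key.2 (s - 1)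
  have e1 : l.take n = l := by rw [← hlen]; simp
  rw [e1, hIl, Nat.sub_add_cancel hs] at h2
  exact good_equiv (SQtop _).symm h2

end CA

/-- Let `r : Fin n → R` be a regular sequence generating the ideal `I`.
For all `s ≥ 1` and `k ≥ 0`, the `R/I`-module `Ext_R^k(R/I^s, R/I)` is free
(for any `R/I`-module structure compatible with the `R`-module structure). -/
theorem stmt_12 (R : Type) [CommRing R] {n : ℕ} (r : Fin n → R)
    (hreg : RingTheory.Sequence.IsRegular R (List.ofFn r))
    (I : Ideal R) (hI : I = Ideal.span (Set.range r)) (s : ℕ) (hs : 1 ≤ s) (k : ℕ)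
    [Module (R ⧸ I) (ExtM R k (R ⧸ (I ^ s)) (R ⧸ I))]
    [IsScalarTower R (R ⧸ I) (ExtM R k (R ⧸ (I ^ s)) (R ⧸ I))] :
    Module.Free (R ⧸ I) (ExtM R k (R ⧸ (I ^ s)) (R ⧸ I)) := by
  obtain ⟨ι, ⟨e⟩⟩ := good_final r hreg I hI s hs k
  obtain ⟨c⟩ := extcmp (ModuleCat.of R (R ⧸ I ^ s)) (ModuleCat.of R (R ⧸ I)) k
  let f : (ExtM R k (R ⧸ (I ^ s)) (R ⧸ I)) ≃ₗ[R] (ι →₀ R ⧸ I) := c ≪≫ₗ e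
  exact Module.Free.of_equiv (f.extendScalarsOfSurjective
    (S := R ⧸ I) Ideal.Quotient.mk_surjective).symm
end
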